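/- arXiv:1403.5691 — 4 statements merged into one kernel-verified Lean document; each statement's English description precedes it below -/
import Mathlib

section
/- Let V be a simple weight module over the ageing algebra 𝔞 and let ḣ be an h-eigenvalue on V. Then either the h-eigenspace V_{ḣ+i} has dimension at most 1 for every i ∈ ℤ, or V_{ḣ+i} is infinite-dimensional for every i ∈ ℤ. -/
noncomputable section

/-- The ageing Lie algebra `𝔞`: a complex Lie algebra with basis `{E, H, P, Q, Z}` and
nonzero brackets `[H,E] = 2E`, `[H,P] = P`, `[H,Q] = -Q`, `[E,Q] = P`, `[P,Q] = Z`,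
with `Z` central and all other brackets of basis elements zero. -/
structure IsAgeingBasis (𝔞 : Type*) [LieRing 𝔞] [LieAlgebra ℂ 𝔞]
    (E H P Q Z : 𝔞) : Prop where
  indep : LinearIndependent ℂ ![E, H, P, Q, Z]
  span : Submodule.span ℂ {E, H, P, Q, Z} = ⊤
  lie_he : ⁅H, E⁆ = (2 : ℂ) • E
  lie_hp : ⁅H, P⁆ = P
  lie_hq : ⁅H, Q⁆ = -Q
  lie_eq : ⁅E, Q⁆ = P
  lie_pq : ⁅P, Q⁆ = Z
  lie_ep : ⁅E, P⁆ = 0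
  lie_ez : ⁅E, Z⁆ = 0
  lie_hz : ⁅H, Z⁆ = 0
  lie_pz : ⁅P, Z⁆ = 0
  lie_qz : ⁅Q, Z⁆ = 0

open Polynomial in
/-- The orbit of `v` under the polynomials in `c`. -/
def polynomialOrbit {V : Type*} [AddCommGroup V] [Module ℂ V]
    (c : Module.End ℂ V) (v : V) : Submodule ℂ V :=
  LinearMap.range ((LinearMap.applyₗ v).comp (aeval (R := ℂ) c).toLinearMap)

/-- Operators `e, h, p, q` on `V` satisfying the relations of the ageing algebra with central
charge `z`, and with no proper nonzero common invariant subspace. -/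
structure IsSimpleAgeingAction {V : Type*} [AddCommGroup V] [Module ℂ V]
    (e h p q : Module.End ℂ V) (z : ℂ) : Prop where
  he : ∀ v, h (e v) = e (h v) + (2 : ℂ) • e v
  hp : ∀ v, h (p v) = p (h v) + p v
  hq : ∀ v, h (q v) = q (h v) - q v
  eq : ∀ v, e (q v) = q (e v) + p v
  ep : ∀ v, e (p v) = p (e v)
  pq : ∀ v, p (q v) = q (p v) + z • v
  simple : ∀ N : Submodule ℂ V, (∀ v ∈ N, e v ∈ N) → (∀ v ∈ N, h v ∈ N) →
    (∀ v ∈ N, p v ∈ N) → (∀ v ∈ N, q v ∈ N) → N = ⊥ ∨ N = ⊤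

section

open Module.End

variable {V : Type*} [AddCommGroup V] [Module ℂ V]

open Polynomial in
lemma mem_polynomialOrbit {c : Module.End ℂ V} {v w : V} :
    w ∈ polynomialOrbit c v ↔ ∃ f : ℂ[X], aeval c f v = w := Iff.rfl

lemma self_mem_polynomialOrbit (c : Module.End ℂ V) (v : V) : v ∈ polynomialOrbit c v :=
  mem_polynomialOrbit.2 ⟨1, by simp⟩

lemma apply_mem_polynomialOrbit {c : Module.End ℂ V} {v w : V}
    (hw : w ∈ polynomialOrbit c v) : c w ∈ polynomialOrbit c v := by
  obtain ⟨f, rfl⟩ := mem_polynomialOrbit.1 hw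
  exact mem_polynomialOrbit.2 ⟨Polynomial.X * f, by simp⟩

lemma pow_apply_mem_polynomialOrbit (c : Module.End ℂ V) (v : V) (n : ℕ) :
    (c ^ n) v ∈ polynomialOrbit c v :=
  mem_polynomialOrbit.2 ⟨Polynomial.X ^ n, by simp⟩

lemma polynomialOrbit_le_of_apply_mem {c : Module.End ℂ V} {v : V} {N : Submodule ℂ V}
    (hv : v ∈ N) (hc : ∀ w ∈ N, c w ∈ N) : polynomialOrbit c v ≤ N := by
  intro w hw
  obtain ⟨f, rfl⟩ := mem_polynomialOrbit.1 hw
  induction f using Polynomial.induction_on' with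
  | add f g hf hg =>
    rw [map_add, LinearMap.add_apply]
    exact N.add_mem (hf ⟨f, rfl⟩) (hg ⟨g, rfl⟩)
  | monomial n a =>
    rw [Polynomial.aeval_monomial, Module.End.mul_apply, Module.algebraMap_end_apply]
    refine N.smul_mem a ?_
    clear hw
    induction n with
    | zero => simpa using hv
    | succ n ih => rw [pow_succ', Module.End.mul_apply]; exact hc _ ih

/-- In a decomposition into eigenvectors only those of eigenvalue `l` contribute to the
`l`-eigenspace. -/
lemma eigenspace_le_of_top_le {h : Module.End ℂ V} {l : ℂ} {A : Submodule ℂ V}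
    (hA : A ≤ eigenspace h l)
    (htop : ⊤ ≤ A ⊔ ⨆ (m : ℂ) (_ : m ≠ l), eigenspace h m) : eigenspace h l ≤ A := by
  intro w hw
  obtain ⟨a, ha, b, hb, rfl⟩ := Submodule.mem_sup.1 (htop (Submodule.mem_top (x := w)))
  have hb' : b ∈ eigenspace h l := by
    simpa using Submodule.sub_mem _ hw (hA ha)
  have : b = 0 := Submodule.disjoint_def.1 (eigenspaces_iSupIndep h l) b hb' hb
  simpa [this] using ha

/-- The canonical commutation relation has no nonzero finite-dimensional representation. -/
lemma subsingleton_of_commutator_eq_one [Module.Finite ℂ V] (y t : Module.End ℂ V)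
    (hyt : y * t - t * y = 1) : Subsingleton V := by
  have := congrArg (LinearMap.trace ℂ V) hyt
  rw [map_sub, LinearMap.trace_mul_comm, sub_self, LinearMap.trace_one] at this
  exact Module.finrank_zero_iff.1 (by exact_mod_cast this.symm)

namespace IsSimpleAgeingAction

variable {e h p q : Module.End ℂ V} {z : ℂ} (S : IsSimpleAgeingAction e h p q z)
include S

lemma eq_zero_or_bijective (f : Module.End ℂ V) (s : ℂ)
    (fe : ∀ v, f (e v) = e (f v)) (fp : ∀ v, f (p v) = p (f v)) (fq : ∀ v, f (q v) = q (f v))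
    (hf : ∀ v, h (f v) = f (h v) + s • f v) : f = 0 ∨ Function.Bijective f := by
  rcases S.simple (LinearMap.ker f) (fun v hv => by simp_all) (fun v hv => by
      have := hf v; simp_all) (fun v hv => by simp_all) (fun v hv => by simp_all) with hk | hk
  · refine (S.simple (LinearMap.range f) ?_ ?_ ?_ ?_).imp LinearMap.range_eq_bot.1
      fun hr => ⟨LinearMap.ker_eq_bot.1 hk, LinearMap.range_eq_top.1 hr⟩
    · rintro _ ⟨v, rfl⟩; exact ⟨e v, fe v⟩
    · rintro _ ⟨v, rfl⟩; exact ⟨h v + s • v, by rw [hf]; simp⟩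
    · rintro _ ⟨v, rfl⟩; exact ⟨p v, fp v⟩
    · rintro _ ⟨v, rfl⟩; exact ⟨q v, fq v⟩
  · exact Or.inl (LinearMap.ker_eq_top.1 hk)

/-- A form of Schur's lemma: an endomorphism generating a weight space is a scalar. -/
lemma rank_le_one_of_le_polynomialOrbit (c : Module.End ℂ V)
    (ce : ∀ v, c (e v) = e (c v)) (ch : ∀ v, c (h v) = h (c v))
    (cp : ∀ v, c (p v) = p (c v)) (cq : ∀ v, c (q v) = q (c v)) (l : ℂ)
    (horb : ∀ v ∈ eigenspace h l, v ≠ 0 → eigenspace h l ≤ polynomialOrbit c v) :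
    Module.rank ℂ (eigenspace h l) ≤ 1 := by
  by_cases hbot : eigenspace h l = ⊥
  · rw [hbot]; simp
  obtain ⟨v, hv, hv0⟩ := Submodule.exists_mem_ne_zero_of_ne_bot hbot
  have hscalar : ∃ a : ℂ, ∀ w, c w = a • w := by
    by_cases hcv : c v = 0
    · rcases S.eq_zero_or_bijective c 0 ce cp cq (fun v => by simp [ch]) with h0 | hb
      · exact ⟨0, fun w => by simp [h0]⟩
      · exact absurd (hb.1 (hcv.trans (map_zero c).symm)) hv0
    · have hcv' : c v ∈ eigenspace h l := by
        rw [mem_eigenspace_iff] at hv ⊢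
        rw [← ch, hv, map_smul]
      obtain ⟨f, hf⟩ := mem_polynomialOrbit.1 (horb _ hcv' hcv hv)
      set g : Polynomial ℂ := f * Polynomial.X - 1 with hg
      have hg0 : g ≠ 0 := by
        intro h0
        have := congrArg (Polynomial.eval 0) h0
        simp [hg] at this
      have hgv : Polynomial.aeval c g v = 0 := by
        simp [hg, hf]
      have hnu : ¬ IsUnit (Polynomial.aeval c g) := by
        intro hu
        exact hv0 (((Module.End.isUnit_iff _).1 hu).1 (hgv.trans (map_zero _).symm))
      obtain ⟨a, ha⟩ : ∃ a : ℂ, ¬ IsUnit (c - algebraMap ℂ _ a) := by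
        rw [(IsAlgClosed.splits g).eq_prod_roots, map_mul, Polynomial.aeval_C] at hnu
        have hu : ¬ IsUnit (Polynomial.aeval c
            (g.roots.map fun a => Polynomial.X - Polynomial.C a).prod) := by
          intro hu
          refine hnu (IsUnit.mul (IsUnit.map (algebraMap ℂ (Module.End ℂ V)) ?_) hu)
          simpa using hg0
        obtain ⟨a, ha, -⟩ := spectrum.exists_mem_of_not_isUnit_aeval_prod hu
        refine ⟨a, fun hu' => spectrum.mem_iff.1 ha ?_⟩
        rw [← neg_sub]; exact hu'.neg
      refine ⟨a, fun w => ?_⟩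
      rcases S.eq_zero_or_bijective (c - algebraMap ℂ _ a) 0 (fun v => by simp [ce])
        (fun v => by simp [cp]) (fun v => by simp [cq]) (fun v => by simp [ch]) with h0 | hb
      · have := LinearMap.congr_fun h0 w
        simpa [sub_eq_zero] using this
      · exact absurd ((Module.End.isUnit_iff _).2 hb) ha
  obtain ⟨a, ha⟩ := hscalar
  refine (rank_submodule_le_one_iff' _).2 ⟨v, (horb v hv hv0).trans ?_⟩
  refine polynomialOrbit_le_of_apply_mem (Submodule.mem_span_singleton_self v) ?_
  intro w hw
  rw [ha]; exact Submodule.smul_mem _ _ hw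

lemma e_apply_mem {l : ℂ} {v : V} (hv : v ∈ eigenspace h l) : e v ∈ eigenspace h (l + 2) := by
  rw [mem_eigenspace_iff] at hv ⊢
  rw [S.he, hv, map_smul, add_smul]

lemma p_apply_mem {l : ℂ} {v : V} (hv : v ∈ eigenspace h l) : p v ∈ eigenspace h (l + 1) := by
  rw [mem_eigenspace_iff] at hv ⊢
  rw [S.hp, hv, map_smul, add_smul, one_smul]

lemma q_apply_mem {l : ℂ} {v : V} (hv : v ∈ eigenspace h l) : q v ∈ eigenspace h (l - 1) := by
  rw [mem_eigenspace_iff] at hv ⊢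
  rw [S.hq, hv, map_smul, sub_smul, one_smul]

lemma e_pow_apply_mem {l : ℂ} {v : V} (hv : v ∈ eigenspace h l) (k : ℕ) :
    (e ^ k) v ∈ eigenspace h (l + 2 * k) := by
  induction k with
  | zero => simpa using hv
  | succ k ih =>
    rw [pow_succ', Module.End.mul_apply]
    convert S.e_apply_mem ih using 2
    push_cast; ring

lemma p_pow_apply_mem {l : ℂ} {v : V} (hv : v ∈ eigenspace h l) (k : ℕ) :
    (p ^ k) v ∈ eigenspace h (l + k) := by
  induction k with
  | zero => simpa using hv
  | succ k ih =>
    rw [pow_succ', Module.End.mul_apply]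
    convert S.p_apply_mem ih using 2
    push_cast; ring

lemma q_pow_apply_mem {l : ℂ} {v : V} (hv : v ∈ eigenspace h l) (k : ℕ) :
    (q ^ k) v ∈ eigenspace h (l - k) := by
  induction k with
  | zero => simpa using hv
  | succ k ih =>
    rw [pow_succ', Module.End.mul_apply]
    convert S.q_apply_mem ih using 2
    push_cast; ring

lemma rank_le_one_of_p_eq_zero (hp0 : p = 0) (l : ℂ) :
    Module.rank ℂ (eigenspace h l) ≤ 1 := by
  have heq : ∀ v, e (q v) = q (e v) := fun v => by simp [S.eq, hp0]
  have hcomm : Commute e q := LinearMap.ext heq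
  refine S.rank_le_one_of_le_polynomialOrbit (e * q ^ 2) ?_ ?_ ?_ ?_ l ?_
  · intro v; simp [pow_two, heq]
  · intro v; simp only [pow_two, Module.End.mul_apply, S.he, S.hq, map_sub]; module
  · intro v; simp [hp0]
  · intro v; simp [pow_two, heq]
  intro v hv hv0
  have hmem : ∀ k j : ℕ, (e ^ k) ((q ^ j) v) ∈ eigenspace h (l - j + 2 * k) := fun k j =>
    S.e_pow_apply_mem (S.q_pow_apply_mem hv j) k
  set N : Submodule ℂ V :=
    Submodule.span ℂ (Set.range fun x : ℕ × ℕ => (e ^ x.1) ((q ^ x.2) v)) with hN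
  have hgen : ∀ k j : ℕ, (e ^ k) ((q ^ j) v) ∈ N := fun k j =>
    Submodule.subset_span ⟨(k, j), rfl⟩
  have hstable : ∀ f : Module.End ℂ V, (∀ k j : ℕ, f ((e ^ k) ((q ^ j) v)) ∈ N) →
      ∀ w ∈ N, f w ∈ N := by
    intro f hf
    change N ≤ N.comap f
    rw [hN, Submodule.span_le]
    rintro _ ⟨⟨k, j⟩, rfl⟩
    exact hf k j
  have hNtop : N = ⊤ := by
    refine (S.simple N (hstable e ?_) (hstable h ?_) (hstable p ?_)
      (hstable q ?_)).resolve_left ?_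
    · intro k j
      have := hgen (k + 1) j
      rwa [pow_succ', Module.End.mul_apply] at this
    · intro k j
      rw [mem_eigenspace_iff.1 (hmem k j)]
      exact Submodule.smul_mem _ _ (hgen k j)
    · intro k j
      simp [hp0]
    · intro k j
      have := hgen k (j + 1)
      rw [pow_succ', Module.End.mul_apply] at this
      have hc := LinearMap.congr_fun (hcomm.pow_left k).eq ((q ^ j) v)
      simp only [Module.End.mul_apply] at hc
      rwa [← hc]
    · intro h0
      have := hgen 0 0
      rw [h0] at this
      exact hv0 (by simpa using this)
  refine eigenspace_le_of_top_le (polynomialOrbit_le_of_apply_mem hv ?_) ?_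
  · intro w hw
    have h1 := S.e_apply_mem (S.q_apply_mem (S.q_apply_mem hw))
    rw [show l - 1 - 1 + 2 = l by ring] at h1
    simpa [pow_two] using h1
  rw [← hNtop, hN, Submodule.span_le]
  rintro _ ⟨⟨k, j⟩, rfl⟩
  by_cases hkj : j = 2 * k
  · refine Submodule.mem_sup_left ?_
    have := pow_apply_mem_polynomialOrbit (e * q ^ 2) v k
    rw [(hcomm.pow_right 2).mul_pow, ← pow_mul, ← hkj] at this
    exact this
  · refine Submodule.mem_sup_right ?_
    refine Submodule.mem_iSup_of_mem (l - j + 2 * k) (Submodule.mem_iSup_of_mem ?_ (hmem k j))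
    intro h0
    refine hkj ?_
    have : (j : ℂ) = 2 * k := by linear_combination -h0
    exact_mod_cast this

lemma rank_le_one_of_e_eq (hz : z ≠ 0) (he : ∀ v, e v = (2 * z)⁻¹ • p (p v)) (l : ℂ) :
    Module.rank ℂ (eigenspace h l) ≤ 1 := by
  set c : Module.End ℂ V := h + z⁻¹ • (p * q) with hc
  have cv : ∀ v, c v = h v + z⁻¹ • p (q v) := fun v => rfl
  have cp : ∀ v, c (p v) = p (c v) := fun v => by
    have h1 : q (p v) = p (q v) - z • v := by rw [S.pq]; module
    simp only [cv, S.hp, h1, map_sub, map_smul, map_add, smul_sub, inv_smul_smul₀ hz]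
    module
  have cq : ∀ v, c (q v) = q (c v) := fun v => by
    simp only [cv, S.hq, S.pq (q v), map_smul, map_add, smul_add, inv_smul_smul₀ hz]
    module
  have ch : ∀ v, c (h v) = h (c v) := fun v => by
    simp only [cv, S.hp, S.hq, map_smul, map_add, map_sub]
    module
  refine S.rank_le_one_of_le_polynomialOrbit c (fun v => by simp [he, cp]) ch cp cq l ?_
  intro v hv hv0
  have hA : polynomialOrbit c v ≤ eigenspace h l :=
    polynomialOrbit_le_of_apply_mem hv fun w hw => by
      rw [mem_eigenspace_iff] at hw ⊢
      rw [← ch, hw, map_smul]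
  have hpq : ∀ w, p (q w) = z • (c w - h w) := fun w => by
    rw [cv, add_sub_cancel_left, smul_inv_smul₀ hz]
  have hqp : ∀ w, q (p w) = z • (c w - h w - w) := fun w => by
    rw [smul_sub, ← hpq, S.pq, add_sub_cancel_right]
  have cpk : ∀ (k : ℕ) w, c ((p ^ k) w) = (p ^ k) (c w) := fun k =>
    LinearMap.congr_fun ((show Commute c p from LinearMap.ext cp).pow_right k).eq
  have cqk : ∀ (k : ℕ) w, c ((q ^ k) w) = (q ^ k) (c w) := fun k =>
    LinearMap.congr_fun ((show Commute c q from LinearMap.ext cq).pow_right k).eq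
  have hhp : ∀ (k : ℕ), ∀ a ∈ polynomialOrbit c v, h ((p ^ k) a) = (l + k) • (p ^ k) a :=
    fun k a ha => mem_eigenspace_iff.1 (S.p_pow_apply_mem (hA ha) k)
  have hhq : ∀ (k : ℕ), ∀ a ∈ polynomialOrbit c v, h ((q ^ k) a) = (l - k) • (q ^ k) a :=
    fun k a ha => mem_eigenspace_iff.1 (S.q_pow_apply_mem (hA ha) k)
  set T : Set V := {w | ∃ k : ℕ, ∃ a ∈ polynomialOrbit c v, w = (p ^ k) a ∨ w = (q ^ k) a}
    with hT
  set N : Submodule ℂ V := Submodule.span ℂ T with hN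
  have hgp : ∀ (k : ℕ), ∀ a ∈ polynomialOrbit c v, (p ^ k) a ∈ N := fun k a ha =>
    Submodule.subset_span ⟨k, a, ha, Or.inl rfl⟩
  have hgq : ∀ (k : ℕ), ∀ a ∈ polynomialOrbit c v, (q ^ k) a ∈ N := fun k a ha =>
    Submodule.subset_span ⟨k, a, ha, Or.inr rfl⟩
  have hstable : ∀ f : Module.End ℂ V,
      (∀ k : ℕ, ∀ a ∈ polynomialOrbit c v, f ((p ^ k) a) ∈ N ∧ f ((q ^ k) a) ∈ N) →
      ∀ w ∈ N, f w ∈ N := by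
    intro f hf
    change N ≤ N.comap f
    rw [hN, Submodule.span_le]
    rintro _ ⟨k, a, ha, rfl | rfl⟩
    exacts [(hf k a ha).1, (hf k a ha).2]
  have hps : ∀ w ∈ N, p w ∈ N := by
    refine hstable p fun k a ha => ⟨?_, ?_⟩
    · have := hgp (k + 1) a ha
      rwa [pow_succ', Module.End.mul_apply] at this
    · cases k with
      | zero => simpa using hgp 1 a ha
      | succ k =>
        rw [pow_succ', Module.End.mul_apply, hpq, cqk, hhq k a ha]
        exact Submodule.smul_mem _ _ (Submodule.sub_mem _
          (hgq k _ (apply_mem_polynomialOrbit ha)) (Submodule.smul_mem _ _ (hgq k a ha)))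
  have hqs : ∀ w ∈ N, q w ∈ N := by
    refine hstable q fun k a ha => ⟨?_, ?_⟩
    · cases k with
      | zero => simpa using hgq 1 a ha
      | succ k =>
        rw [pow_succ', Module.End.mul_apply, hqp, cpk, hhp k a ha]
        exact Submodule.smul_mem _ _ (Submodule.sub_mem _ (Submodule.sub_mem _
          (hgp k _ (apply_mem_polynomialOrbit ha)) (Submodule.smul_mem _ _ (hgp k a ha)))
          (hgp k a ha))
    · have := hgq (k + 1) a ha
      rwa [pow_succ', Module.End.mul_apply] at this
  have hNtop : N = ⊤ := by
    refine (S.simple N ?_ (hstable h ?_) hps hqs).resolve_left ?_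
    · intro w hw
      rw [he]
      exact Submodule.smul_mem _ _ (hps _ (hps _ hw))
    · intro k a ha
      rw [hhp k a ha, hhq k a ha]
      exact ⟨Submodule.smul_mem _ _ (hgp k a ha), Submodule.smul_mem _ _ (hgq k a ha)⟩
    · intro h0
      have := hgp 0 v (self_mem_polynomialOrbit c v)
      rw [h0] at this
      exact hv0 (by simpa using this)
  refine eigenspace_le_of_top_le hA ?_
  rw [← hNtop, hN, Submodule.span_le]
  rintro _ ⟨k, a, ha, hw⟩
  rcases Nat.eq_zero_or_pos k with rfl | hk
  · refine Submodule.mem_sup_left ?_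
    rcases hw with rfl | rfl <;> simpa using ha
  · have hk' : (k : ℂ) ≠ 0 := by exact_mod_cast hk.ne'
    refine Submodule.mem_sup_right ?_
    rcases hw with rfl | rfl
    · exact Submodule.mem_iSup_of_mem (l + k) (Submodule.mem_iSup_of_mem (by simpa using hk')
        (S.p_pow_apply_mem (hA ha) k))
    · exact Submodule.mem_iSup_of_mem (l - k) (Submodule.mem_iSup_of_mem (by simpa using hk')
        (S.q_pow_apply_mem (hA ha) k))

omit S in
lemma not_finite_of_eigenspace_eq_bot {hc : ℂ} (hev : HasEigenvalue h hc)
    (hfin : ∀ l, Module.Finite ℂ (eigenspace h l) → eigenspace h l = ⊥)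
    (hup : ∀ l, eigenspace h l = ⊥ → eigenspace h (l + 1) = ⊥)
    (hdown : ∀ l, eigenspace h l = ⊥ → eigenspace h (l - 1) = ⊥) (i : ℤ) :
    ¬ Module.Finite ℂ (eigenspace h (hc + i)) := by
  intro hi
  have key : ∀ j : ℤ, eigenspace h (hc + i + j) = ⊥ := by
    intro j
    induction j with
    | zero => simpa using hfin _ hi
    | succ j ih =>
      convert hup _ ih using 2
      push_cast; ring
    | pred j ih =>
      convert hdown _ ih using 2
      push_cast; ring
  refine hev (?_ : eigenspace h hc = ⊥)
  simpa using key (-i)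

lemma eigenspace_eq_bot_of_p_bijective (hz : z = 0) (hp : Function.Bijective p) (l : ℂ)
    (hfin : Module.Finite ℂ (eigenspace h l)) : eigenspace h l = ⊥ := by
  set P := LinearEquiv.ofBijective p hp with hP
  have Pv : ∀ v, p (P.symm v) = v := fun v => P.apply_symm_apply v
  have hpq : ∀ v, p (q v) = q (p v) := fun v => by simp [S.pq, hz]
  have hy : ∀ w ∈ eigenspace h l, P.symm (P.symm (e w)) ∈ eigenspace h l := by
    intro w hw
    rw [mem_eigenspace_iff]
    refine hp.1 (hp.1 ?_)
    have h1 := S.e_apply_mem hw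
    rw [mem_eigenspace_iff] at h1
    set y := P.symm (P.symm (e w)) with hy
    have h2 : p (p y) = e w := by rw [hy, Pv, Pv]
    have h3 : h (p (p y)) = p (p (h y)) + (2 : ℂ) • p (p y) := by
      rw [S.hp, S.hp, map_add]; module
    rw [h2, h1, add_smul] at h3
    rw [map_smul, map_smul, h2]
    exact (add_right_cancel h3).symm
  have ht : ∀ w ∈ eigenspace h l, q (p w) ∈ eigenspace h l := by
    intro w hw
    simpa using S.q_apply_mem (S.p_apply_mem hw)
  have hs := subsingleton_of_commutator_eq_one
    (LinearMap.restrict (P.symm.toLinearMap ∘ₗ P.symm.toLinearMap ∘ₗ e) hy)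
    (LinearMap.restrict (q * p) ht) ?_
  · exact (Submodule.subsingleton_iff_eq_bot).1 hs
  · ext w
    have : P.symm (P.symm (e (q (p w)))) - q (p (P.symm (P.symm (e w)))) = (w : V) := by
      refine hp.1 (hp.1 ?_)
      simp only [map_sub, hpq, Pv, S.eq, S.ep]
      abel
    simpa using this

lemma not_finite_of_p_bijective (hz : z = 0) (hp : Function.Bijective p) {hc : ℂ}
    (hev : HasEigenvalue h hc) (i : ℤ) : ¬ Module.Finite ℂ (eigenspace h (hc + i)) := by
  refine not_finite_of_eigenspace_eq_bot hev (S.eigenspace_eq_bot_of_p_bijective hz hp) ?_ ?_ i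
  · intro l hl
    rw [Submodule.eq_bot_iff] at hl ⊢
    intro w hw
    obtain ⟨u, rfl⟩ := hp.2 w
    rw [hl u, map_zero]
    rw [mem_eigenspace_iff] at hw ⊢
    rw [S.hp, add_smul, one_smul] at hw
    refine hp.1 ?_
    rw [map_smul]
    exact add_right_cancel hw
  · intro l hl
    rw [Submodule.eq_bot_iff] at hl ⊢
    intro w hw
    refine hp.1 ?_
    rw [map_zero]
    exact hl _ (by simpa using S.p_apply_mem hw)

lemma not_finite_of_sub_bijective (hz : z ≠ 0)
    (hb : Function.Bijective (e - (2 * z)⁻¹ • (p * p))) {hc : ℂ}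
    (hev : HasEigenvalue h hc) (i : ℤ) : ¬ Module.Finite ℂ (eigenspace h (hc + i)) := by
  set f : Module.End ℂ V := e - (2 * z)⁻¹ • (p * p) with hf
  set c : Module.End ℂ V := h + z⁻¹ • (p * q) with hc
  have fv : ∀ v, f v = e v - (2 * z)⁻¹ • p (p v) := fun v => rfl
  have cv : ∀ v, c v = h v + z⁻¹ • p (q v) := fun v => rfl
  have hqp : ∀ v, q (p v) = p (q v) - z • v := fun v => by rw [S.pq]; module
  have hqe : ∀ v, q (e v) = e (q v) - p v := fun v => by rw [S.eq]; module
  have cp : ∀ v, c (p v) = p (c v) := fun v => by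
    simp only [cv, S.hp, hqp, map_sub, map_smul, map_add, smul_sub, inv_smul_smul₀ hz]
    module
  have cq : ∀ v, c (q v) = q (c v) := fun v => by
    simp only [cv, S.hq, S.pq (q v), map_smul, map_add, smul_add, inv_smul_smul₀ hz]
    module
  have ch : ∀ v, c (h v) = h (c v) := fun v => by
    simp only [cv, S.hp, S.hq, map_smul, map_add, map_sub]
    module
  have hhf : ∀ v, h (f v) = f (h v) + (2 : ℂ) • f v := fun v => by
    simp only [fv, S.he, S.hp, map_smul, map_add, map_sub]
    module
  have cf : ∀ v, c (f v) = f (c v) + (2 : ℂ) • f v := fun v => by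
    have h1 : c (e v) = e (c v) + (2 : ℂ) • f v := by
      simp only [cv, fv, S.he, hqe, S.ep, map_smul, map_add, map_sub]
      match_scalars <;> field_simp
    rw [fv (c v), fv v, map_sub, map_smul, cp, cp, h1, fv v]
    module
  have hno : ∀ (m : ℂ) (v : V), c v = m • v → v = 0 := by
    intro m v hv
    by_contra hv0
    set K : Submodule ℂ V := ⨆ n : ℕ, eigenspace c (m + 2 * n) with hK
    have hle : ∀ n : ℕ, eigenspace c (m + 2 * n) ≤ K := fun n =>
      le_iSup (fun n : ℕ => eigenspace c (m + 2 * n)) n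
    have hfK : ∀ (n : ℕ), ∀ w ∈ eigenspace c (m + 2 * n),
        f w ∈ eigenspace c (m + 2 * (n + 1 : ℕ)) := by
      intro n w hw
      rw [mem_eigenspace_iff] at hw ⊢
      rw [cf, hw, map_smul]
      push_cast
      module
    have hstable : ∀ g : Module.End ℂ V, (∀ w, c (g w) = g (c w)) → ∀ w ∈ K, g w ∈ K := by
      intro g hg
      change K ≤ K.comap g
      refine iSup_le fun n w hw => hle n ?_
      rw [mem_eigenspace_iff] at hw ⊢
      rw [hg, hw, map_smul]
    have hKtop : K = ⊤ := by
      refine (S.simple K ?_ (hstable h ch) (hstable p cp) (hstable q cq)).resolve_left ?_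
      · intro w hw
        have h1 : f w ∈ K := by
          revert w
          change K ≤ K.comap f
          exact iSup_le fun n w hw => hle (n + 1) (hfK n w hw)
        have h2 : e w = f w + (2 * z)⁻¹ • p (p w) := by rw [fv, sub_add_cancel]
        rw [h2]
        exact Submodule.add_mem _ h1 (Submodule.smul_mem _ _
          (hstable p cp _ (hstable p cp _ hw)))
      · intro h0
        have : v ∈ K := hle 0 (by rw [mem_eigenspace_iff, hv]; simp)
        rw [h0] at this
        exact hv0 (by simpa using this)
    obtain ⟨u, hu⟩ := hb.2 v
    have hB : f u ∈ ⨆ (a : ℂ) (_ : a ≠ m), eigenspace c a := by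
      have : K ≤ (⨆ (a : ℂ) (_ : a ≠ m), eigenspace c a).comap f := by
        refine iSup_le fun n w hw => ?_
        refine Submodule.mem_iSup_of_mem (m + 2 * (n + 1 : ℕ))
          (Submodule.mem_iSup_of_mem ?_ (hfK n w hw))
        intro h0
        have h1 : ((n + 1 : ℕ) : ℂ) = 0 := by linear_combination h0 / 2
        exact absurd h1 (by exact_mod_cast n.succ_ne_zero)
      exact this (hKtop ▸ Submodule.mem_top)
    rw [hu] at hB
    exact hv0 (Submodule.disjoint_def.1 (eigenspaces_iSupIndep c m) v
      (mem_eigenspace_iff.2 hv) hB)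
  have hup2 : ∀ l, eigenspace h l = ⊥ → eigenspace h (l + 2) = ⊥ := by
    intro l hl
    rw [Submodule.eq_bot_iff] at hl ⊢
    intro w hw
    obtain ⟨u, rfl⟩ := hb.2 w
    rw [hl u, map_zero]
    rw [mem_eigenspace_iff] at hw ⊢
    rw [hhf, add_smul] at hw
    refine hb.1 ?_
    rw [map_smul]
    exact add_right_cancel hw
  have hdown2 : ∀ l, eigenspace h l = ⊥ → eigenspace h (l - 2) = ⊥ := by
    intro l hl
    rw [Submodule.eq_bot_iff] at hl ⊢
    intro w hw
    refine hb.1 ?_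
    rw [map_zero]
    refine hl _ ?_
    rw [mem_eigenspace_iff] at hw ⊢
    rw [hhf, hw, map_smul]
    module
  have hmid : ∀ l, eigenspace h (l - 1) = ⊥ → eigenspace h (l + 1) = ⊥ →
      eigenspace h l = ⊥ := by
    intro l h1 h2
    rw [Submodule.eq_bot_iff] at h1 h2 ⊢
    intro w hw
    have h3 := S.pq w
    rw [h1 _ (S.q_apply_mem hw), h2 _ (S.p_apply_mem hw)] at h3
    simpa [hz] using h3.symm
  refine not_finite_of_eigenspace_eq_bot hev ?_ ?_ ?_ i
  · intro l hfin
    by_contra hbot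
    have hcl : ∀ w ∈ eigenspace h l, c w ∈ eigenspace h l := by
      intro w hw
      rw [mem_eigenspace_iff] at hw ⊢
      rw [← ch, hw, map_smul]
    have : Nontrivial (eigenspace h l) := Submodule.nontrivial_iff_ne_bot.2 hbot
    obtain ⟨m, hm⟩ := Module.End.exists_eigenvalue (LinearMap.restrict c hcl)
    obtain ⟨v, hv⟩ := hm.exists_hasEigenvector
    refine hv.2 (Subtype.ext (hno m v ?_))
    exact congrArg Subtype.val hv.apply_eq_smul
  · intro l hl
    refine hmid _ (by simpa using hl) ?_
    convert hup2 l hl using 2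
    ring
  · intro l hl
    refine hmid _ ?_ (by simpa using hl)
    convert hdown2 l hl using 2
    ring

theorem rank_le_one_or_not_finite {hc : ℂ} (hev : HasEigenvalue h hc) :
    (∀ i : ℤ, Module.rank ℂ (eigenspace h (hc + i)) ≤ 1) ∨
      ∀ i : ℤ, ¬ Module.Finite ℂ (eigenspace h (hc + i)) := by
  by_cases hz : z = 0
  · rcases S.eq_zero_or_bijective p 1 (fun v => (S.ep v).symm) (fun v => rfl)
      (fun v => by simp [S.pq, hz]) (fun v => by simp [S.hp]) with h0 | hb
    · exact Or.inl fun i => S.rank_le_one_of_p_eq_zero h0 _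
    · exact Or.inr (S.not_finite_of_p_bijective hz hb hev)
  · refine (S.eq_zero_or_bijective (e - (2 * z)⁻¹ • (p * p)) 2 ?_ ?_ ?_ ?_).imp
      (fun h0 i => S.rank_le_one_of_e_eq hz (fun v => ?_) _)
      fun hb => S.not_finite_of_sub_bijective hz hb hev
    · intro v; simp [S.ep]
    · intro v; simp [S.ep]
    · intro v
      simp only [LinearMap.sub_apply, LinearMap.smul_apply, Module.End.mul_apply, S.eq, S.pq,
        map_add, map_sub, map_smul]
      match_scalars <;> field_simp <;> ring
    · intro v
      simp only [LinearMap.sub_apply, LinearMap.smul_apply, Module.End.mul_apply, S.he, S.hp,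
        map_add, map_sub, map_smul]
      module
    · simpa [sub_eq_zero] using LinearMap.congr_fun h0 v

end IsSimpleAgeingAction

lemma IsAgeingBasis.isSimpleAgeingAction {𝔞 : Type*} [LieRing 𝔞] [LieAlgebra ℂ 𝔞]
    {E H P Q Z : 𝔞} (hA : IsAgeingBasis 𝔞 E H P Q Z) [LieRingModule 𝔞 V] [LieModule ℂ 𝔞 V]
    (hsimple : LieModule.IsIrreducible ℂ 𝔞 V) (zc : ℂ) (hz : ∀ v : V, ⁅Z, v⁆ = zc • v) :
    IsSimpleAgeingAction (LieModule.toEnd ℂ 𝔞 V E) (LieModule.toEnd ℂ 𝔞 V H)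
      (LieModule.toEnd ℂ 𝔞 V P) (LieModule.toEnd ℂ 𝔞 V Q) zc where
  he v := by
    simp only [LieModule.toEnd_apply_apply]
    rw [leibniz_lie, hA.lie_he, smul_lie, add_comm]
  hp v := by
    simp only [LieModule.toEnd_apply_apply]
    rw [leibniz_lie, hA.lie_hp, add_comm]
  hq v := by
    simp only [LieModule.toEnd_apply_apply]
    rw [leibniz_lie, hA.lie_hq, neg_lie]; abel
  eq v := by
    simp only [LieModule.toEnd_apply_apply]
    rw [leibniz_lie, hA.lie_eq, add_comm]
  ep v := by
    simp only [LieModule.toEnd_apply_apply]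
    rw [leibniz_lie, hA.lie_ep, zero_lie, zero_add]
  pq v := by
    simp only [LieModule.toEnd_apply_apply]
    rw [leibniz_lie, hA.lie_pq, hz, add_comm]
  simple N hNe hNh hNp hNq := by
    have hN : ∀ x : 𝔞, ∀ v ∈ N, ⁅x, v⁆ ∈ N := by
      intro x v hv
      have hx : x ∈ Submodule.span ℂ {E, H, P, Q, Z} := hA.span ▸ Submodule.mem_top
      induction hx using Submodule.span_induction with
      | mem x hx =>
        simp only [Set.mem_insert_iff, Set.mem_singleton_iff] at hx
        rcases hx with rfl | rfl | rfl | rfl | rfl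
        exacts [hNe v hv, hNh v hv, hNp v hv, hNq v hv, hz v ▸ N.smul_mem _ hv]
      | zero => simp
      | add x y _ _ hx hy => rw [add_lie]; exact N.add_mem hx hy
      | smul a x _ hx => rw [smul_lie]; exact N.smul_mem _ hx
    let L : LieSubmodule ℂ 𝔞 V := { N with lie_mem := fun {x v} hv => hN x v hv }
    have hL : L.toSubmodule = N := rfl
    rcases eq_bot_or_eq_top L with h0 | h0
    · left; rw [← hL, h0]; simp
    · right; rw [← hL, h0]; simp

end

/-- Let `V` be a simple weight module over the ageing algebra `𝔞`
(i.e. `H` acts diagonalizably and `Z` acts as a scalar `zc`), and let `hc` be an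
`H`-eigenvalue on `V`.  Then either every eigenspace `V_{hc+i}`, `i ∈ ℤ`, has dimension
at most `1`, or every eigenspace `V_{hc+i}`, `i ∈ ℤ`, is infinite-dimensional. -/
theorem weight_spaces_dichotomy
    {𝔞 : Type*} [LieRing 𝔞] [LieAlgebra ℂ 𝔞] {E H P Q Z : 𝔞}
    (hA : IsAgeingBasis 𝔞 E H P Q Z)
    {V : Type*} [AddCommGroup V] [Module ℂ V] [LieRingModule 𝔞 V] [LieModule ℂ 𝔞 V]
    (hsimple : LieModule.IsIrreducible ℂ 𝔞 V)
    (zc : ℂ) (hz : ∀ v : V, ⁅Z, v⁆ = zc • v)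
    (hwt : ⨆ μ : ℂ, Module.End.eigenspace (LieModule.toEnd ℂ 𝔞 V H) μ = ⊤)
    (hc : ℂ) (hev : Module.End.HasEigenvalue (LieModule.toEnd ℂ 𝔞 V H) hc) :
    (∀ i : ℤ, Module.rank ℂ
        (Module.End.eigenspace (LieModule.toEnd ℂ 𝔞 V H) (hc + i)) ≤ 1) ∨
    (∀ i : ℤ, ¬ Module.Finite ℂ
        (Module.End.eigenspace (LieModule.toEnd ℂ 𝔞 V H) (hc + i))) := by
  exact (hA.isSimpleAgeingAction hsimple zc hz).rank_le_one_or_not_finite hev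

end
end

section
/- For any ż, ḣ ∈ ℂ and any R_ż-module N, the formulas defining N_{ż,ḣ} endow the vector space N ⊗ ℂ[x,x⁻¹] with the structure of a module over the ageing algebra 𝔞. -/
noncomputable section

/-- The operator `d/dt` on `ℂ[t]`. -/
def Dt : Module.End ℂ (Polynomial ℂ) := Polynomial.derivative

/-- The operator of multiplication by `t` on `ℂ[t]`. -/
def Tm : Module.End ℂ (Polynomial ℂ) := LinearMap.mulLeft ℂ Polynomial.X

/-- The first Weyl algebra, realized as the subalgebra of endomorphisms of `ℂ[t]`
generated by `d/dt` and multiplication by `t`. -/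
def WeylA : Subalgebra ℂ (Module.End ℂ (Polynomial ℂ)) := Algebra.adjoin ℂ {Dt, Tm}

/-- `R₀`: the subalgebra of the Weyl algebra generated by `t` and `t²(d/dt)`. -/
def R0 : Subalgebra ℂ (Module.End ℂ (Polynomial ℂ)) := Algebra.adjoin ℂ {Tm, Tm ^ 2 * Dt}

/-- `R₁`: the subalgebra of the Weyl algebra generated by `t` and `t(d/dt)`. -/
def R1 : Subalgebra ℂ (Module.End ℂ (Polynomial ℂ)) := Algebra.adjoin ℂ {Tm, Tm * Dt}

/-- `R_zc`, which is `R₀` for `zc = 0` and `R₁` otherwise. -/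
def Rz (zc : ℂ) : Subalgebra ℂ (Module.End ℂ (Polynomial ℂ)) := if zc = 0 then R0 else R1

/-- The element `t` of `R_zc`. -/
def tR (zc : ℂ) : Rz zc :=
  ⟨Tm, by unfold Rz; split <;> exact Algebra.subset_adjoin (by simp)⟩

/-- The second canonical generator of `R_zc`: `t²(d/dt)` if `zc = 0` and `t(d/dt)` otherwise. -/
def dR (zc : ℂ) : Rz zc :=
  ⟨if zc = 0 then Tm ^ 2 * Dt else Tm * Dt, by
    unfold Rz; split_ifs <;> exact Algebra.subset_adjoin (by simp)⟩

/-- The element of `R_zc` by which `p` acts from weight `ḣ - i` (up to the shift in the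
Laurent variable): `t` if `zc = 0`, and `2zc·t(d/dt) + (i-1)zc` if `zc ≠ 0`. -/
def pOp (zc : ℂ) (i : ℤ) : Rz zc :=
  if zc = 0 then tR zc else (2 * zc) • dR zc + (((i : ℂ) - 1) * zc) • 1

/-- The element of `R_zc` by which `e` acts from weight `ḣ - i` (up to the shift in the
Laurent variable): `t²(d/dt) + (i-2)t` if `zc = 0`, and
`t + (2i-3)zc·t(d/dt) + 2zc·(t(d/dt))² + ((i-1)(i-2)/2)zc` if `zc ≠ 0`. -/
def eOp (zc : ℂ) (i : ℤ) : Rz zc :=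
  if zc = 0 then dR zc + ((i : ℂ) - 2) • tR zc
  else tR zc + ((2 * (i : ℂ) - 3) * zc) • dR zc + (2 * zc) • (dR zc) ^ 2 +
    (((i : ℂ) - 1) * ((i : ℂ) - 2) / 2 * zc) • 1


/-- The `𝔞`-module `N_{zc,hc}`: the vector space `N ⊗ ℂ[x,x⁻¹]` (realized as the space
`ℤ →₀ N` of finitely supported families, with `Finsupp.single i v` corresponding to
`v ⊗ xⁱ`) together with an `𝔞`-module structure in which
`h(v⊗xⁱ) = (hc-i)·v⊗xⁱ`, `z(v⊗xⁱ) = zc·v⊗xⁱ`, `q(v⊗xⁱ) = v⊗x^{i+1}`,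
`p(v⊗xⁱ) = (pOp zc i · v)⊗x^{i-1}` and `e(v⊗xⁱ) = (eOp zc i · v)⊗x^{i-2}`. -/
structure AgeingModuleOnFinsupp (𝔞 : Type*) [LieRing 𝔞] [LieAlgebra ℂ 𝔞]
    (E H P Q Z : 𝔞) (zc hc : ℂ) (N : Type*) [AddCommGroup N] [Module ℂ N]
    [Module (Rz zc) N] [IsScalarTower ℂ (Rz zc) N] where
  [lieRingModule : LieRingModule 𝔞 (ℤ →₀ N)]
  [lieModule : LieModule ℂ 𝔞 (ℤ →₀ N)]
  act_h : ∀ (i : ℤ) (v : N),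
    ⁅H, Finsupp.single i v⁆ = (hc - (i : ℂ)) • Finsupp.single i v
  act_z : ∀ (i : ℤ) (v : N),
    ⁅Z, Finsupp.single i v⁆ = zc • Finsupp.single i v
  act_q : ∀ (i : ℤ) (v : N),
    ⁅Q, Finsupp.single i v⁆ = Finsupp.single (i + 1) v
  act_p : ∀ (i : ℤ) (v : N),
    ⁅P, Finsupp.single i v⁆ = Finsupp.single (i - 1) (pOp zc i • v)
  act_e : ∀ (i : ℤ) (v : N),
    ⁅E, Finsupp.single i v⁆ = Finsupp.single (i - 2) (eOp zc i • v)

attribute [local instance] LieRing.ofAssociativeRing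

/-- A linear map between Lie algebras that preserves brackets of pairs `b i`, `b j` of basis
vectors with `i < j` preserves all brackets. -/
lemma map_lie_of_basis {R L L' ι : Type*} [CommRing R] [LieRing L] [LieAlgebra R L]
    [LieRing L'] [LieAlgebra R L'] [LinearOrder ι] (b : Module.Basis ι R L) (φ : L →ₗ[R] L')
    (h : ∀ i j, i < j → φ ⁅b i, b j⁆ = ⁅φ (b i), φ (b j)⁆) (x y : L) :
    φ ⁅x, y⁆ = ⁅φ x, φ y⁆ := by
  have key : (LieModule.toEnd R L L).toLinearMap.compr₂ φ =
      (LieModule.toEnd R L' L').toLinearMap.compl₁₂ φ φ := by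
    refine LinearMap.ext_basis b b fun i j => ?_
    change φ ⁅b i, b j⁆ = ⁅φ (b i), φ (b j)⁆
    rcases lt_trichotomy i j with hij | rfl | hij
    · exact h i j hij
    · simp
    · rw [← lie_skew (b i) (b j), ← lie_skew (φ (b i)) (φ (b j)), map_neg, h j i hij]
  exact LinearMap.congr_fun₂ key x y

lemma Dt_mul_Tm : Dt * Tm = Tm * Dt + 1 := by
  refine LinearMap.ext fun f => ?_
  simp [Dt, Tm, add_comm]

lemma dR_mul_tR_of_eq_zero : dR 0 * tR 0 = tR 0 * dR 0 + tR 0 * tR 0 := by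
  apply Subtype.ext
  simp only [dR, tR, MulMemClass.mk_mul_mk, AddMemClass.mk_add_mk, if_true, mul_assoc, Dt_mul_Tm]
  noncomm_ring

lemma dR_mul_tR {zc : ℂ} (hz : zc ≠ 0) : dR zc * tR zc = tR zc * dR zc + tR zc := by
  apply Subtype.ext
  simp only [dR, tR, MulMemClass.mk_mul_mk, AddMemClass.mk_add_mk, if_neg hz, mul_assoc, Dt_mul_Tm]
  noncomm_ring

lemma pOp_add_one_sub (zc : ℂ) (i : ℤ) : pOp zc (i + 1) - pOp zc i = zc • 1 := by
  rcases eq_or_ne zc 0 with rfl | hz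
  · simp only [pOp, if_true, zero_smul]
    exact sub_self (tR 0)
  · simp only [pOp, if_neg hz]
    push_cast
    module

lemma eOp_add_one_sub (zc : ℂ) (i : ℤ) : eOp zc (i + 1) - eOp zc i = pOp zc i := by
  rcases eq_or_ne zc 0 with rfl | hz
  · simp only [eOp, pOp, if_true]
    push_cast
    module
  · simp only [eOp, pOp, if_neg hz]
    push_cast
    module

lemma eOp_mul_pOp (zc : ℂ) (i : ℤ) :
    eOp zc (i - 1) * pOp zc i = pOp zc (i - 2) * eOp zc i := by
  rcases eq_or_ne zc 0 with rfl | hz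
  · simp only [eOp, pOp, if_true, add_mul, mul_add, smul_mul_assoc, mul_smul_comm,
      dR_mul_tR_of_eq_zero]
    push_cast
    module
  · simp only [eOp, pOp, if_neg hz, add_mul, mul_add, smul_mul_assoc, mul_smul_comm,
      dR_mul_tR hz, one_mul, mul_one, ← pow_succ, ← pow_succ', ← pow_two]
    push_cast
    module

/-- The operator `v ⊗ xⁱ ↦ (f i • v) ⊗ xⁱ⁺ᵏ` on `N ⊗ ℂ[x,x⁻¹]`. -/
def shiftOp {A : Type*} [Ring A] [Algebra ℂ A] (N : Type*) [AddCommGroup N] [Module ℂ N]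
    [Module A N] [IsScalarTower ℂ A N] (k : ℤ) (f : ℤ → A) : Module.End ℂ (ℤ →₀ N) :=
  Finsupp.lsum ℂ fun i => Finsupp.lsingle (i + k) ∘ₗ Algebra.lsmul ℂ ℂ N (f i)

section shiftOp

variable {A : Type*} [Ring A] [Algebra ℂ A] {N : Type*} [AddCommGroup N] [Module ℂ N]
  [Module A N] [IsScalarTower ℂ A N]

lemma shiftOp_single (k : ℤ) (f : ℤ → A) (i : ℤ) (v : N) :
    shiftOp N k f (Finsupp.single i v) = Finsupp.single (i + k) (f i • v) := by
  simp [shiftOp]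

lemma lie_shiftOp_eq_smul {k l m : ℤ} {f g h : ℤ → A} (c : ℂ) (hm : k + l = m)
    (hc : ∀ i, f (i + l) * g i - g (i + k) * f i = c • h i) :
    ⁅shiftOp N k f, shiftOp N l g⁆ = c • shiftOp N m h := by
  refine Finsupp.lhom_ext fun i v => ?_
  rw [LieRing.of_associative_ring_bracket]
  simp only [LinearMap.sub_apply, Module.End.mul_apply, LinearMap.smul_apply, shiftOp_single,
    Finsupp.smul_single]
  rw [← smul_assoc c, ← hc, sub_smul, mul_smul, mul_smul, Finsupp.single_sub, ← hm,
    add_assoc, add_assoc, add_comm l k]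

lemma lie_shiftOp_eq_zero {k l : ℤ} {f g : ℤ → A}
    (hc : ∀ i, f (i + l) * g i = g (i + k) * f i) :
    ⁅shiftOp N k f, shiftOp N l g⁆ = 0 := by
  rw [lie_shiftOp_eq_smul (h := fun _ => 0) 0 rfl fun i => by simp [hc], zero_smul]

end shiftOp

/-- The operators by which `e, h, p, q, z` act on `N_{zc,hc}`, in this order. -/
def ageingOps (zc hc : ℂ) (N : Type*) [AddCommGroup N] [Module ℂ N]
    [Module (Rz zc) N] [IsScalarTower ℂ (Rz zc) N] : Fin 5 → Module.End ℂ (ℤ →₀ N) :=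
  ![shiftOp N (-2) (eOp zc), shiftOp N 0 fun i => (hc - (i : ℂ)) • (1 : Rz zc),
    shiftOp N (-1) (pOp zc), shiftOp N 1 fun _ => (1 : Rz zc),
    shiftOp N 0 fun _ => zc • (1 : Rz zc)]

/-- The basis `e, h, p, q, z` of the ageing algebra. -/
def IsAgeingBasis.basis {𝔞 : Type*} [LieRing 𝔞] [LieAlgebra ℂ 𝔞] {E H P Q Z : 𝔞}
    (hA : IsAgeingBasis 𝔞 E H P Q Z) : Module.Basis (Fin 5) ℂ 𝔞 :=
  Module.Basis.mk hA.indep (by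
    simp only [Matrix.range_cons, Matrix.range_empty, Set.union_empty, Set.singleton_union]
    exact hA.span.ge)

lemma IsAgeingBasis.basis_apply {𝔞 : Type*} [LieRing 𝔞] [LieAlgebra ℂ 𝔞] {E H P Q Z : 𝔞}
    (hA : IsAgeingBasis 𝔞 E H P Q Z) (k : Fin 5) : hA.basis k = ![E, H, P, Q, Z] k := by
  simp [IsAgeingBasis.basis]

/-- The operators `ageingOps zc hc N` define a representation of the ageing algebra. -/
lemma IsAgeingBasis.exists_rep {𝔞 : Type*} [LieRing 𝔞] [LieAlgebra ℂ 𝔞] {E H P Q Z : 𝔞}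
    (hA : IsAgeingBasis 𝔞 E H P Q Z) (zc hc : ℂ) (N : Type*) [AddCommGroup N] [Module ℂ N]
    [Module (Rz zc) N] [IsScalarTower ℂ (Rz zc) N] :
    ∃ ρ : 𝔞 →ₗ⁅ℂ⁆ Module.End ℂ (ℤ →₀ N),
      ∀ k, ρ (![E, H, P, Q, Z] k) = ageingOps zc hc N k := by
  set φ := hA.basis.constr ℂ (ageingOps zc hc N)
  have hφ : ∀ k, φ (![E, H, P, Q, Z] k) = ageingOps zc hc N k := fun k => by
    rw [← hA.basis_apply]
    exact hA.basis.constr_basis ℂ _ k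
  refine ⟨{ φ with map_lie' := fun {x y} => map_lie_of_basis hA.basis φ (fun i j hij => ?_) x y },
    hφ⟩
  rw [hA.basis_apply, hA.basis_apply, hφ, hφ]
  have hE : φ E = _ := hφ 0
  have hP : φ P = _ := hφ 2
  have hQ : φ Q = _ := hφ 3
  have hZ : φ Z = _ := hφ 4
  fin_cases i <;> fin_cases j <;> first | exact absurd hij (by decide) | skip
  · change φ ⁅E, H⁆ = _
    rw [← lie_skew, hA.lie_he, ← neg_smul, map_smul, hE]
    refine (lie_shiftOp_eq_smul _ (by norm_num) fun i => ?_).symm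
    simp only [smul_mul_assoc, mul_smul_comm, one_mul, mul_one, add_zero]
    push_cast
    module
  · change φ ⁅E, P⁆ = _
    rw [hA.lie_ep, map_zero]
    exact (lie_shiftOp_eq_zero (eOp_mul_pOp zc)).symm
  · change φ ⁅E, Q⁆ = _
    rw [hA.lie_eq, hP, ← one_smul ℂ (ageingOps zc hc N 2)]
    refine (lie_shiftOp_eq_smul _ (by norm_num) fun i => ?_).symm
    rw [mul_one, one_mul, one_smul, eOp_add_one_sub]
  · change φ ⁅E, Z⁆ = _
    rw [hA.lie_ez, map_zero]
    exact (lie_shiftOp_eq_zero fun i => by simp).symm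
  · change φ ⁅H, P⁆ = _
    rw [hA.lie_hp, hP, ← one_smul ℂ (ageingOps zc hc N 2)]
    refine (lie_shiftOp_eq_smul _ (by norm_num) fun i => ?_).symm
    simp only [smul_mul_assoc, mul_smul_comm, one_mul, mul_one, add_zero]
    push_cast
    module
  · change φ ⁅H, Q⁆ = _
    rw [hA.lie_hq, map_neg, hQ, ← neg_one_smul ℂ (ageingOps zc hc N 3)]
    refine (lie_shiftOp_eq_smul _ (by norm_num) fun i => ?_).symm
    simp only [mul_one, one_mul]
    push_cast
    module
  · change φ ⁅H, Z⁆ = _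
    rw [hA.lie_hz, map_zero]
    exact (lie_shiftOp_eq_zero fun i => by simp [smul_comm zc]).symm
  · change φ ⁅P, Q⁆ = _
    rw [hA.lie_pq, hZ, ← one_smul ℂ (ageingOps zc hc N 4)]
    refine (lie_shiftOp_eq_smul _ (by norm_num) fun i => ?_).symm
    rw [mul_one, one_mul, one_smul, pOp_add_one_sub]
  · change φ ⁅P, Z⁆ = _
    rw [hA.lie_pz, map_zero]
    exact (lie_shiftOp_eq_zero fun i => by simp).symm
  · change φ ⁅Q, Z⁆ = _
    rw [hA.lie_qz, map_zero]
    exact (lie_shiftOp_eq_zero fun i => by simp).symm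

/-- For any `zc, hc ∈ ℂ` and any `R_zc`-module `N`, the formulas
defining `N_{zc,hc}` endow the vector space `N ⊗ ℂ[x,x⁻¹]` with the structure of a
module over the ageing algebra `𝔞`. -/
theorem exists_ageing_module_structure
    {𝔞 : Type*} [LieRing 𝔞] [LieAlgebra ℂ 𝔞] {E H P Q Z : 𝔞}
    (hA : IsAgeingBasis 𝔞 E H P Q Z) (zc hc : ℂ)
    (N : Type*) [AddCommGroup N] [Module ℂ N]
    [Module (Rz zc) N] [IsScalarTower ℂ (Rz zc) N] :
    Nonempty (AgeingModuleOnFinsupp 𝔞 E H P Q Z zc hc N) := by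
  obtain ⟨ρ, hρ⟩ := hA.exists_rep zc hc N
  let _ : LieRingModule 𝔞 (ℤ →₀ N) := LieRingModule.compLieHom (ℤ →₀ N) ρ
  have : LieModule ℂ 𝔞 (ℤ →₀ N) := LieModule.compLieHom (ℤ →₀ N) ρ
  have act : ∀ k w, ⁅![E, H, P, Q, Z] k, w⁆ = ageingOps zc hc N k w := fun k w =>
    LinearMap.congr_fun (hρ k) w
  refine ⟨AgeingModuleOnFinsupp.mk (fun i v => (act 1 _).trans ?_) (fun i v => (act 4 _).trans ?_)
    (fun i v => (act 3 _).trans ?_) (fun i v => (act 2 _).trans ?_)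
    (fun i v => (act 0 _).trans ?_)⟩ <;>
  simp [ageingOps, shiftOp_single, sub_eq_add_neg]

end
end

section
/- Let ż, ḣ ∈ ℂ and let N be an R_ż-module. The 𝔞-module N_{ż,ḣ} is simple if and only if N is a simple R_ż-module and one of the following holds: (i) ż = 0 and (ℂt + ℂ t²(d/dt))N ≠ 0; (ii) ż ≠ 0 and τ_{i,ż}(ℂt + ℂ t(d/dt))N ≠ 0 for all i ∈ ℤ. -/
noncomputable section

/-- The subalgebra `R_zc` is generated by its two canonical generators. -/
theorem Rz_induction {zc : ℂ} {motive : Rz zc → Prop} (t : motive (tR zc)) (d : motive (dR zc))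
    (algebraMap : ∀ c, motive (algebraMap ℂ (Rz zc) c))
    (add : ∀ r s, motive r → motive s → motive (r + s))
    (mul : ∀ r s, motive r → motive s → motive (r * s)) (r : Rz zc) : motive r := by
  have hR : Rz zc = Algebra.adjoin ℂ {(tR zc : Module.End ℂ (Polynomial ℂ)), ↑(dR zc)} := by
    by_cases hz : zc = 0 <;> simp [Rz, R0, R1, tR, dR, hz]
  obtain ⟨x, hx⟩ := r
  have hx' := hx
  rw [hR] at hx'
  suffices ∃ h : x ∈ Rz zc, motive ⟨x, h⟩ from this.2
  induction hx' using Algebra.adjoin_induction with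
  | mem y hy =>
    rcases hy with rfl | rfl
    · exact ⟨_, t⟩
    · exact ⟨_, d⟩
  | algebraMap c => exact ⟨_, algebraMap c⟩
  | add y y' hy hy' ih ih' =>
    rw [← hR] at hy hy'
    obtain ⟨h, m⟩ := ih hy
    obtain ⟨h', m'⟩ := ih' hy'
    exact ⟨_, add _ _ m m'⟩
  | mul y y' hy hy' ih ih' =>
    rw [← hR] at hy hy'
    obtain ⟨h, m⟩ := ih hy
    obtain ⟨h', m'⟩ := ih' hy'
    exact ⟨_, mul _ _ m m'⟩

/-- Over a simple `R_zc`-module, a subspace stable under both generators is trivial. -/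
theorem eq_bot_or_eq_top_of_stable {zc : ℂ} {N : Type*} [AddCommGroup N] [Module ℂ N]
    [Module (Rz zc) N] [IsScalarTower ℂ (Rz zc) N] [IsSimpleModule (Rz zc) N]
    (W : Submodule ℂ N) (t : ∀ v ∈ W, tR zc • v ∈ W) (d : ∀ v ∈ W, dR zc • v ∈ W) :
    W = ⊥ ∨ W = ⊤ := by
  have stable : ∀ r : Rz zc, ∀ v ∈ W, r • v ∈ W := by
    intro r
    induction r using Rz_induction with
    | t => exact t
    | d => exact d
    | algebraMap c => intro v hv; rw [algebraMap_smul]; exact W.smul_mem c hv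
    | add r s hr hs => intro v hv; rw [add_smul]; exact W.add_mem (hr v hv) (hs v hv)
    | mul r s hr hs => intro v hv; rw [mul_smul]; exact hr _ (hs v hv)
  let U : Submodule (Rz zc) N := { W with smul_mem' := fun r v hv => stable r v hv }
  have := (isSimpleModule_iff (Rz zc) N).mp inferInstance
  rcases eq_bot_or_eq_top U with hU | hU
  · exact Or.inl (SetLike.ext fun v => SetLike.ext_iff.mp hU v)
  · exact Or.inr (SetLike.ext fun v => SetLike.ext_iff.mp hU v)

/-- The action of the generators of `𝔞` on `N ⊗ ℂ[x,x⁻¹]` when `p` and `e` act on `N ⊗ xⁱ`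
through the maps `p i` and `e i`. -/
structure IsGradedAction {𝔞 N : Type*} [LieRing 𝔞] [LieAlgebra ℂ 𝔞] [AddCommGroup N]
    [Module ℂ N] [LieRingModule 𝔞 (ℤ →₀ N)] (E H P Q Z : 𝔞) (zc hc : ℂ)
    (p e : ℤ → N → N) : Prop where
  span : Submodule.span ℂ {E, H, P, Q, Z} = ⊤
  act_h : ∀ (i : ℤ) (v : N), ⁅H, Finsupp.single i v⁆ = (hc - (i : ℂ)) • Finsupp.single i v
  act_z : ∀ (i : ℤ) (v : N), ⁅Z, Finsupp.single i v⁆ = zc • Finsupp.single i v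
  act_q : ∀ (i : ℤ) (v : N), ⁅Q, Finsupp.single i v⁆ = Finsupp.single (i + 1) v
  act_p : ∀ (i : ℤ) (v : N), ⁅P, Finsupp.single i v⁆ = Finsupp.single (i - 1) (p i v)
  act_e : ∀ (i : ℤ) (v : N), ⁅E, Finsupp.single i v⁆ = Finsupp.single (i - 2) (e i v)

/-- The families `W` for which `⨁ i, W i ⊗ xⁱ` is stable under `q`, `p` and `e`. -/
structure IsStableFamily {N : Type*} [AddCommGroup N] [Module ℂ N] (p e : ℤ → N → N)
    (W : ℤ → Submodule ℂ N) : Prop where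
  q_mem : ∀ i, ∀ v ∈ W i, v ∈ W (i + 1)
  p_mem : ∀ i, ∀ v ∈ W i, p i v ∈ W (i - 1)
  e_mem : ∀ i, ∀ v ∈ W i, e i v ∈ W (i - 2)

namespace IsGradedAction

variable {𝔞 N : Type*} [LieRing 𝔞] [LieAlgebra ℂ 𝔞] [AddCommGroup N] [Module ℂ N]
  [LieRingModule 𝔞 (ℤ →₀ N)] {E H P Q Z : 𝔞} {zc hc : ℂ}
  {p e : ℤ → N → N}

theorem lie_h_apply (hact : IsGradedAction E H P Q Z zc hc p e) (f : ℤ →₀ N) (k : ℤ) :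
    ⁅H, f⁆ k = (hc - (k : ℂ)) • f k := by
  induction f using Finsupp.induction_linear with
  | zero => simp
  | add f g hf hg => rw [lie_add, Finsupp.add_apply, Finsupp.add_apply, hf, hg, smul_add]
  | single i v =>
    rw [hact.act_h]
    by_cases h : i = k
    · subst h; simp
    · simp [Finsupp.single_eq_of_ne' h]

theorem isStableFamily_comap (hact : IsGradedAction E H P Q Z zc hc p e)
    (W : LieSubmodule ℂ 𝔞 (ℤ →₀ N)) :
    IsStableFamily p e fun i => W.toSubmodule.comap (Finsupp.lsingle i) where
  q_mem i v hv := by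
    have := W.lie_mem (x := Q) hv
    rwa [Finsupp.lsingle_apply, hact.act_q] at this
  p_mem i v hv := by
    have := W.lie_mem (x := P) hv
    rwa [Finsupp.lsingle_apply, hact.act_p] at this
  e_mem i v hv := by
    have := W.lie_mem (x := E) hv
    rwa [Finsupp.lsingle_apply, hact.act_e] at this

/-- Submodules are graded, since `h` acts with distinct eigenvalues. -/
theorem single_mem (hact : IsGradedAction E H P Q Z zc hc p e)
    (W : LieSubmodule ℂ 𝔞 (ℤ →₀ N)) {w : ℤ →₀ N} (hw : w ∈ W) (i : ℤ) :
    Finsupp.single i (w i) ∈ W := by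
  classical
  have key : ∀ S : Finset ℤ, ∃ f ∈ W, ∀ k, f k = (∏ j ∈ S, ((j : ℂ) - k)) • w k := by
    intro S
    induction S using Finset.induction_on with
    | empty => exact ⟨w, hw, by simp⟩
    | insert a S ha ih =>
      obtain ⟨f, hf, hfk⟩ := ih
      refine ⟨⁅H, f⁆ + ((a : ℂ) - hc) • f, W.add_mem (W.lie_mem hf) (W.smul_mem _ hf), ?_⟩
      intro k
      rw [Finsupp.add_apply, hact.lie_h_apply, Finsupp.smul_apply, hfk,
        Finset.prod_insert ha]
      module
  obtain ⟨f, hf, hfk⟩ := key (w.support.erase i)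
  set c : ℂ := ∏ j ∈ w.support.erase i, ((j : ℂ) - i) with hc_def
  have hc0 : c ≠ 0 := Finset.prod_ne_zero_iff.mpr fun j hj =>
    sub_ne_zero.mpr (by exact_mod_cast Finset.ne_of_mem_erase hj)
  have hfs : Finsupp.single i (w i) = c⁻¹ • f := by
    ext k
    rw [Finsupp.smul_apply, hfk]
    by_cases hk : k = i
    · subst hk
      rw [Finsupp.single_eq_same, ← hc_def, inv_smul_smul₀ hc0]
    · rw [Finsupp.single_eq_of_ne hk]
      by_cases hwk : w k = 0
      · simp [hwk]
      · have hmem : k ∈ w.support.erase i := by simp [hk, hwk]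
        rw [Finset.prod_eq_zero hmem (sub_self (k : ℂ)), zero_smul, smul_zero]
  rw [hfs]
  exact W.smul_mem _ hf

variable [LieModule ℂ 𝔞 (ℤ →₀ N)]

/-- The submodule `⨁ i, W i ⊗ xⁱ` attached to a stable family `W`. -/
def lieSubmodule (hact : IsGradedAction E H P Q Z zc hc p e) {W : ℤ → Submodule ℂ N}
    (hW : IsStableFamily p e W) : LieSubmodule ℂ 𝔞 (ℤ →₀ N) where
  carrier := {f | ∀ i, f i ∈ W i}
  zero_mem' i := (W i).zero_mem
  add_mem' hf hg i := (W i).add_mem (hf i) (hg i)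
  smul_mem' c _ hf i := (W i).smul_mem c (hf i)
  lie_mem := by
    intro x f hf k
    have single_apply_mem : ∀ {i : ℤ} {v : N}, v ∈ W i → Finsupp.single i v k ∈ W k := by
      intro i v hv
      by_cases h : i = k
      · subst h; simpa using hv
      · simp [Finsupp.single_eq_of_ne' h]
    have of_single : ∀ y : 𝔞, (∀ i, ∀ v ∈ W i, ⁅y, Finsupp.single i v⁆ k ∈ W k) →
        ⁅y, f⁆ k ∈ W k := by
      intro y hy
      rw [← f.sum_single, Finsupp.sum, lie_sum, Finsupp.finsetSum_apply]
      exact (W k).sum_mem fun i _ => hy i _ (hf i)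
    have hx : x ∈ Submodule.span ℂ {E, H, P, Q, Z} := by rw [hact.span]; trivial
    induction hx using Submodule.span_induction with
    | mem y hy =>
      refine of_single y fun i v hv => ?_
      rcases hy with rfl | rfl | rfl | rfl | rfl
      · rw [hact.act_e]; exact single_apply_mem (hW.e_mem i v hv)
      · rw [hact.act_h]; exact (W k).smul_mem _ (single_apply_mem hv)
      · rw [hact.act_p]; exact single_apply_mem (hW.p_mem i v hv)
      · rw [hact.act_q]; exact single_apply_mem (hW.q_mem i v hv)
      · rw [hact.act_z]; exact (W k).smul_mem _ (single_apply_mem hv)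
    | zero => simp
    | add y y' _ _ h h' => rw [add_lie]; exact (W k).add_mem h h'
    | smul c y _ h => rw [smul_lie]; exact (W k).smul_mem c h

theorem mem_lieSubmodule (hact : IsGradedAction E H P Q Z zc hc p e) {W : ℤ → Submodule ℂ N}
    (hW : IsStableFamily p e W) {f : ℤ →₀ N} : f ∈ hact.lieSubmodule hW ↔ ∀ i, f i ∈ W i :=
  Iff.rfl

theorem isIrreducible_iff (hact : IsGradedAction E H P Q Z zc hc p e) :
    LieModule.IsIrreducible ℂ 𝔞 (ℤ →₀ N) ↔
      Nontrivial N ∧ ∀ W : ℤ → Submodule ℂ N, IsStableFamily p e W →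
        (∀ i, W i = ⊥) ∨ (∀ i, W i = ⊤) := by
  constructor
  · intro h
    have hM : Nontrivial (ℤ →₀ N) := (LieSubmodule.nontrivial_iff ℂ 𝔞 _).mp inferInstance
    refine ⟨?_, fun W hW => ?_⟩
    · by_contra hN
      rw [not_nontrivial_iff_subsingleton] at hN
      exact not_subsingleton (ℤ →₀ N) inferInstance
    · rcases eq_bot_or_eq_top (hact.lieSubmodule hW) with h' | h'
      · left
        intro i
        rw [Submodule.eq_bot_iff]
        intro v hv
        have : Finsupp.single i v ∈ hact.lieSubmodule hW := by
          rw [mem_lieSubmodule]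
          intro k
          by_cases hk : i = k
          · subst hk; simpa using hv
          · simp [Finsupp.single_eq_of_ne' hk]
        rw [h', LieSubmodule.mem_bot] at this
        simpa using this
      · right
        intro i
        rw [Submodule.eq_top_iff']
        intro v
        have : Finsupp.single i v ∈ hact.lieSubmodule hW := h' ▸ LieSubmodule.mem_top _
        simpa using (hact.mem_lieSubmodule hW).mp this i
  · rintro ⟨hN, h⟩
    refine LieModule.IsIrreducible.mk fun W hW => ?_
    rcases h _ (hact.isStableFamily_comap W) with h' | h'
    · refine absurd ((LieSubmodule.eq_bot_iff _).mpr fun w hw => ?_) hW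
      ext i
      have : w i ∈ W.toSubmodule.comap (Finsupp.lsingle i) := hact.single_mem W hw i
      rw [h' i] at this
      simpa using this
    · rw [eq_top_iff]
      intro w _
      rw [← w.sum_single]
      refine sum_mem fun i _ => ?_
      have : w i ∈ W.toSubmodule.comap (Finsupp.lsingle i) := h' i ▸ Submodule.mem_top
      exact this

end IsGradedAction

section Families

variable {zc : ℂ} {N : Type*} [AddCommGroup N] [Module (Rz zc) N]

theorem pOp_zero_smul (hz : zc = 0) (i : ℤ) (v : N) : pOp zc i • v = tR zc • v := by
  simp [pOp, hz]

variable [Module ℂ N]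

theorem step_isStableFamily (n : ℤ) (hp : ∀ v : N, pOp zc n • v = 0)
    (he : ∀ v : N, eOp zc n • v = 0) (he' : ∀ v : N, eOp zc (n + 1) • v = 0) :
    IsStableFamily (fun i (v : N) => pOp zc i • v) (fun i v => eOp zc i • v)
      (fun i => if n ≤ i then ⊤ else ⊥) where
  q_mem i v hv := by
    by_cases hi : n ≤ i
    · simp [show n ≤ i + 1 by lia]
    · simp_all
  p_mem i v hv := by
    by_cases hi : n ≤ i
    · rcases hi.eq_or_lt with rfl | hi
      · simp [hp]
      · simp [show n ≤ i - 1 by lia]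
    · simp_all
  e_mem i v hv := by
    by_cases hi : n ≤ i
    · rcases (show i = n ∨ i = n + 1 ∨ n ≤ i - 2 by lia) with rfl | rfl | hi
      · simp [he]
      · simp [he']
      · simp [hi]
    · simp_all

variable [IsScalarTower ℂ (Rz zc) N]

theorem eOp_zero_smul (hz : zc = 0) (i : ℤ) (v : N) :
    eOp zc i • v = dR zc • v + ((i : ℂ) - 2) • tR zc • v := by
  rw [eOp, if_pos hz, add_smul, smul_assoc]

theorem pOp_smul (hz : zc ≠ 0) (i : ℤ) (v : N) :
    pOp zc i • v = (2 * zc) • (dR zc + algebraMap ℂ (Rz zc) (((i - 1 : ℤ) : ℂ) / 2)) • v := by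
  rw [pOp, if_neg hz, add_smul, add_smul, smul_assoc, smul_assoc, one_smul, algebraMap_smul]
  push_cast
  generalize dR zc • v = u
  module

theorem eOp_smul (hz : zc ≠ 0) (i : ℤ) (v : N) :
    eOp zc i • v = tR zc • v + (2 * zc) • (dR zc • dR zc • v) +
      ((2 * (i : ℂ) - 3) * zc) • dR zc • v +
      (((i : ℂ) - 1) * ((i : ℂ) - 2) / 2 * zc) • v := by
  rw [eOp, if_neg hz, add_smul, add_smul, add_smul, smul_assoc, smul_assoc, smul_assoc, one_smul,
    pow_two, mul_smul (dR zc) (dR zc) v]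
  abel

/-- If only trivial families are stable, then no step family is. -/
theorem exists_ne_zero_of_stable_trivial [Nontrivial N]
    (h : ∀ W : ℤ → Submodule ℂ N,
      IsStableFamily (fun i (v : N) => pOp zc i • v) (fun i v => eOp zc i • v) W →
        (∀ i, W i = ⊥) ∨ (∀ i, W i = ⊤)) :
    (zc = 0 ∧ ∃ v : N, tR zc • v ≠ 0 ∨ dR zc • v ≠ 0) ∨
      (zc ≠ 0 ∧ ∀ i : ℤ, ∃ v : N,
        tR zc • v ≠ 0 ∨ (dR zc + algebraMap ℂ (Rz zc) ((i : ℂ) / 2)) • v ≠ 0) := by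
  have not_step : ∀ n : ℤ, ¬ ((∀ v : N, pOp zc n • v = 0) ∧ (∀ v : N, eOp zc n • v = 0) ∧
      ∀ v : N, eOp zc (n + 1) • v = 0) := by
    rintro n ⟨hp, he, he'⟩
    rcases h _ (step_isStableFamily n hp he he') with h' | h'
    · simpa using h' n
    · simpa using h' (n - 1)
  by_cases hz : zc = 0
  · refine Or.inl ⟨hz, ?_⟩
    by_contra! hv
    refine not_step 0 ⟨fun v => ?_, fun v => ?_, fun v => ?_⟩
    · rw [pOp_zero_smul hz, (hv v).1]
    · rw [eOp_zero_smul hz, (hv v).1, (hv v).2, smul_zero, add_zero]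
    · rw [eOp_zero_smul hz, (hv v).1, (hv v).2, smul_zero, add_zero]
  · refine Or.inr ⟨hz, fun i => ?_⟩
    by_contra! hv
    have hd : ∀ v : N, dR zc • v = (-(i : ℂ) / 2) • v := by
      intro v
      have := (hv v).2
      rw [add_smul, algebraMap_smul, add_eq_zero_iff_eq_neg] at this
      rw [this]
      module
    refine not_step (i + 1) ⟨fun v => ?_, fun v => ?_, fun v => ?_⟩
    · rw [pOp_smul hz, add_sub_cancel_right, (hv v).2, smul_zero]
    · rw [eOp_smul hz, (hv v).1, hd, hd]
      push_cast
      module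
    · rw [eOp_smul hz, (hv v).1, hd, hd]
      push_cast
      module

/-- In a stable family, `t` and the shifted second generator lower the index. -/
theorem IsStableFamily.lower {W : ℤ → Submodule ℂ N}
    (hW : IsStableFamily (fun i (v : N) => pOp zc i • v) (fun i v => eOp zc i • v) W)
    (i : ℤ) {v : N} (hv : v ∈ W i) :
    tR zc • v ∈ W (i - 1) ∧
      (dR zc + algebraMap ℂ (Rz zc) (if zc = 0 then 0 else ((i - 1 : ℤ) : ℂ) / 2)) • v ∈
        W (i - 1) := by
  have hp := hW.p_mem i v hv
  have he := hW.q_mem _ _ (hW.e_mem i v hv)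
  rw [show i - 2 + 1 = i - 1 by ring] at he
  by_cases hz : zc = 0
  · rw [if_pos hz, map_zero, add_zero]
    simp only [pOp_zero_smul hz, eOp_zero_smul hz] at hp he
    exact ⟨hp, (Submodule.add_mem_iff_left _ (Submodule.smul_mem _ _ hp)).mp he⟩
  · rw [if_neg hz]
    have hp' : ∀ u ∈ W i,
        (dR zc + algebraMap ℂ (Rz zc) (((i - 1 : ℤ) : ℂ) / 2)) • u ∈ W (i - 1) := by
      intro u hu
      have := hW.p_mem i u hu
      simp only [pOp_smul hz] at this
      exact ((W (i - 1)).smul_mem_iff (mul_ne_zero two_ne_zero hz)).mp this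
    refine ⟨?_, hp' v hv⟩
    have hd : dR zc • v ∈ W i := by
      have := hW.q_mem _ _ (hp' v hv)
      rw [sub_add_cancel, add_smul, algebraMap_smul] at this
      exact (Submodule.add_mem_iff_left _ (Submodule.smul_mem _ _ hv)).mp this
    have factor : eOp zc i • v = tR zc • v + (2 * zc) •
        ((dR zc + algebraMap ℂ (Rz zc) (((i - 1 : ℤ) : ℂ) / 2)) • dR zc • v +
        (((i : ℂ) - 2) / 2) • (dR zc + algebraMap ℂ (Rz zc) (((i - 1 : ℤ) : ℂ) / 2)) • v) := by
      rw [eOp_smul hz, add_smul, add_smul, algebraMap_smul, algebraMap_smul]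
      push_cast
      generalize dR zc • dR zc • v = u₂
      generalize dR zc • v = u₁
      generalize tR zc • v = u₀
      module
    simp only [factor] at he
    exact (Submodule.add_mem_iff_left _ (Submodule.smul_mem _ _
      (Submodule.add_mem _ (hp' _ hd) (Submodule.smul_mem _ _ (hp' v hv))))).mp he

theorem IsStableFamily.eq_bot_or_eq_top [IsSimpleModule (Rz zc) N] {W : ℤ → Submodule ℂ N}
    (hW : IsStableFamily (fun i (v : N) => pOp zc i • v) (fun i v => eOp zc i • v) W)
    (h : (zc = 0 ∧ ∃ v : N, tR zc • v ≠ 0 ∨ dR zc • v ≠ 0) ∨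
      (zc ≠ 0 ∧ ∀ i : ℤ, ∃ v : N,
        tR zc • v ≠ 0 ∨ (dR zc + algebraMap ℂ (Rz zc) ((i : ℂ) / 2)) • v ≠ 0)) :
    (∀ i, W i = ⊥) ∨ (∀ i, W i = ⊤) := by
  have up : ∀ i, ∀ v ∈ W (i - 1), v ∈ W i := fun i v hv => by
    simpa using hW.q_mem (i - 1) v hv
  have dichotomy : ∀ i, W i = ⊥ ∨ W i = ⊤ := by
    refine fun i => eq_bot_or_eq_top_of_stable (W i)
      (fun v hv => up i _ (hW.lower i hv).1) fun v hv => ?_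
    have := up i _ (hW.lower i hv).2
    rw [add_smul, algebraMap_smul] at this
    exact (Submodule.add_mem_iff_left _ (Submodule.smul_mem _ _ hv)).mp this
  have descend : ∀ i, W i = ⊤ → W (i - 1) = ⊤ := by
    intro i hi
    refine (dichotomy (i - 1)).resolve_left fun hbot => ?_
    have low : ∀ v : N, tR zc • v = 0 ∧
        (dR zc + algebraMap ℂ (Rz zc) (if zc = 0 then 0 else ((i - 1 : ℤ) : ℂ) / 2)) • v = 0 := by
      intro v
      have := hW.lower i (v := v) (hi ▸ Submodule.mem_top)
      simpa only [hbot, Submodule.mem_bot] using this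
    rcases h with ⟨hz, v, hv⟩ | ⟨hz, hv⟩
    · have := low v
      rw [if_pos hz, map_zero, add_zero] at this
      exact hv.elim (· this.1) (· this.2)
    · obtain ⟨v, hv⟩ := hv (i - 1)
      have := low v
      rw [if_neg hz] at this
      exact hv.elim (· this.1) (· this.2)
  refine or_iff_not_imp_left.mpr fun hne => ?_
  obtain ⟨n, hn⟩ := not_forall.mp hne
  intro i
  induction i using Int.inductionOn' (b := n) with
  | zero => exact (dichotomy n).resolve_left hn
  | succ k _ ih => exact eq_top_iff.mpr fun v _ => hW.q_mem k v (ih ▸ Submodule.mem_top)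
  | pred k _ ih => exact descend k ih

end Families

/-- Let `zc, hc ∈ ℂ` and let `N` be an `R_zc`-module.  The `𝔞`-module
`N_{zc,hc}` (the space `ℤ →₀ N`, i.e. `N ⊗ ℂ[x,x⁻¹]` with `Finsupp.single i v`
corresponding to `v ⊗ xⁱ`, equipped with the defining formulas of `N_{zc,hc}`) is simple
if and only if `N` is a simple `R_zc`-module and either `zc = 0` and
`(ℂt + ℂt²(d/dt))N ≠ 0`, or `zc ≠ 0` and `τ_{i,zc}(ℂt + ℂt(d/dt))N ≠ 0` for all
`i ∈ ℤ` (here `τ_{i,zc}(t) = t` and `τ_{i,zc}(t(d/dt)) = t(d/dt) + i/2`). -/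
theorem Nzh_simple_iff
    {𝔞 : Type*} [LieRing 𝔞] [LieAlgebra ℂ 𝔞] {E H P Q Z : 𝔞}
    (hA : IsAgeingBasis 𝔞 E H P Q Z) (zc hc : ℂ)
    (N : Type*) [AddCommGroup N] [Module ℂ N]
    [Module (Rz zc) N] [IsScalarTower ℂ (Rz zc) N]
    [LieRingModule 𝔞 (ℤ →₀ N)] [LieModule ℂ 𝔞 (ℤ →₀ N)]
    (act_h : ∀ (i : ℤ) (v : N),
      ⁅H, Finsupp.single i v⁆ = (hc - (i : ℂ)) • Finsupp.single i v)
    (act_z : ∀ (i : ℤ) (v : N),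
      ⁅Z, Finsupp.single i v⁆ = zc • Finsupp.single i v)
    (act_q : ∀ (i : ℤ) (v : N),
      ⁅Q, Finsupp.single i v⁆ = Finsupp.single (i + 1) v)
    (act_p : ∀ (i : ℤ) (v : N),
      ⁅P, Finsupp.single i v⁆ = Finsupp.single (i - 1) (pOp zc i • v))
    (act_e : ∀ (i : ℤ) (v : N),
      ⁅E, Finsupp.single i v⁆ = Finsupp.single (i - 2) (eOp zc i • v)) :
    LieModule.IsIrreducible ℂ 𝔞 (ℤ →₀ N) ↔
      (IsSimpleModule (Rz zc) N ∧
        ((zc = 0 ∧ ∃ v : N, tR zc • v ≠ 0 ∨ dR zc • v ≠ 0) ∨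
         (zc ≠ 0 ∧ ∀ i : ℤ, ∃ v : N,
            tR zc • v ≠ 0 ∨ (dR zc + algebraMap ℂ (Rz zc) ((i : ℂ) / 2)) • v ≠ 0))) := by
  have hact : IsGradedAction E H P Q Z zc hc (fun i (v : N) => pOp zc i • v)
      (fun i v => eOp zc i • v) := ⟨hA.span, act_h, act_z, act_q, act_p, act_e⟩
  rw [hact.isIrreducible_iff]
  constructor
  · rintro ⟨hN, h⟩
    refine ⟨?_, ?_⟩
    · rw [isSimpleModule_iff]
      refine { eq_bot_or_eq_top := fun U => ?_ }
      rcases h (fun _ => U.restrictScalars ℂ)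
        ⟨fun _ _ hv => hv, fun _ _ hv => U.smul_mem _ hv, fun _ _ hv => U.smul_mem _ hv⟩
        with h' | h'
      · exact Or.inl (by simpa using h' 0)
      · exact Or.inr (by simpa using h' 0)
    · exact exists_ne_zero_of_stable_trivial h
  · rintro ⟨hN, h⟩
    exact ⟨IsSimpleModule.nontrivial (Rz zc) N, fun W hW => hW.eq_bot_or_eq_top h⟩

end
end

section
/- For each ż ∈ ℂ, the left ideal R_ż t of R_ż is a two-sided ideal; the quotient algebra R_1/R_1 t is isomorphic to the commutative polynomial algebra ℂ[ts] in the image of t(d/dt), and R_0/R_0 t is isomorphic to the commutative polynomial algebra ℂ[t²s] in the image of t²(d/dt). Consequently, every simple quotient of the left R_ż-module R_ż/R_ż t is one-dimensional. -/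
set_option synthInstance.maxHeartbeats 1000000
set_option maxHeartbeats 2000000


open scoped TensorProduct

noncomputable section

/-- The element `t` of `R₀`. -/
def tR0 : R0 := ⟨Tm, Algebra.subset_adjoin (by simp)⟩

/-- The element `t²(d/dt)` of `R₀`. -/
def dR0 : R0 := ⟨Tm ^ 2 * Dt, Algebra.subset_adjoin (by simp)⟩

/-- The element `t` of `R₁`. -/
def tR1 : R1 := ⟨Tm, Algebra.subset_adjoin (by simp)⟩

/-- The element `t(d/dt)` of `R₁`. -/
def dR1 : R1 := ⟨Tm * Dt, Algebra.subset_adjoin (by simp)⟩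

open Polynomial in
/-- If `t` and `d` generate `S`, `S * t` absorbs right multiplication by `d`, and `ℂ[d]` meets `S * t`
trivially, then `S / S * t` is the polynomial algebra on the image of `d`. -/
theorem exists_algHom_polynomial_of_adjoin_eq_top {S : Type*} [Ring S] [Algebra ℂ S] (t d e : S)
    (hgen : Algebra.adjoin ℂ {t, d} = ⊤) (hcomm : t * d = e * t)
    (hinj : ∀ (q : ℂ[X]) (r : S), aeval d q = r * t → q = 0) :
    ∃ ψ : S →ₐ[ℂ] ℂ[X], Function.Surjective ψ ∧ ψ d = X ∧
      ∀ x : S, ψ x = 0 ↔ x ∈ Ideal.span {t} := by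
  have hright : ∀ x : S, ∃ y, t * x = y * t := by
    intro x
    have hx : x ∈ Algebra.adjoin ℂ {t, d} := hgen ▸ Algebra.mem_top
    induction hx using Algebra.adjoin_induction with
    | mem x hx =>
      rcases hx with rfl | rfl
      exacts [⟨_, rfl⟩, ⟨e, hcomm⟩]
    | algebraMap c => exact ⟨algebraMap ℂ S c, (Algebra.commutes c t).symm⟩
    | add x y _ _ hx hy =>
      obtain ⟨a, ha⟩ := hx
      obtain ⟨b, hb⟩ := hy
      exact ⟨a + b, by rw [mul_add, ha, hb, add_mul]⟩
    | mul x y _ _ hx hy =>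
      obtain ⟨a, ha⟩ := hx
      obtain ⟨b, hb⟩ := hy
      exact ⟨a * b, by rw [← mul_assoc, ha, mul_assoc, hb, mul_assoc]⟩
  have hdecomp : ∀ x : S, ∃ (q : ℂ[X]) (r : S), x = aeval d q + r * t := by
    intro x
    have hx : x ∈ Algebra.adjoin ℂ {t, d} := hgen ▸ Algebra.mem_top
    induction hx using Algebra.adjoin_induction with
    | mem x hx =>
      rcases hx with rfl | rfl
      exacts [⟨0, 1, by simp⟩, ⟨X, 0, by simp⟩]
    | algebraMap c => exact ⟨C c, 0, by simp⟩
    | add x y _ _ hx hy =>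
      obtain ⟨p, r, rfl⟩ := hx
      obtain ⟨q, s, rfl⟩ := hy
      exact ⟨p + q, r + s, by rw [map_add, add_mul]; abel⟩
    | mul x y _ _ hx hy =>
      obtain ⟨p, r, rfl⟩ := hx
      obtain ⟨q, s, rfl⟩ := hy
      obtain ⟨y, hy⟩ := hright (aeval d q + s * t)
      refine ⟨p * q, aeval d p * s + r * y, ?_⟩
      rw [add_mul, mul_assoc r, hy, map_mul, mul_add, add_mul]
      simp only [mul_assoc, add_assoc]
  have : (Ideal.span {t}).IsTwoSided := ⟨fun {a} b ha => by
    obtain ⟨r, rfl⟩ := Ideal.mem_span_singleton'.1 ha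
    obtain ⟨y, hy⟩ := hright b
    exact Ideal.mem_span_singleton'.2 ⟨r * y, by rw [mul_assoc, ← hy, mul_assoc]⟩⟩
  let π := Ideal.Quotient.mkₐ ℂ (Ideal.span {t})
  have hπ : ∀ x, π x = 0 ↔ x ∈ Ideal.span {t} := fun x => Ideal.Quotient.eq_zero_iff_mem
  have hbij : Function.Bijective (π.comp (aeval d)) := by
    constructor
    · rw [injective_iff_map_eq_zero]
      intro q hq
      obtain ⟨r, hr⟩ := Ideal.mem_span_singleton'.1 ((hπ _).1 hq)
      exact hinj q r hr.symm
    · intro y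
      obtain ⟨x, rfl⟩ := Ideal.Quotient.mkₐ_surjective ℂ (Ideal.span {t}) y
      obtain ⟨q, r, rfl⟩ := hdecomp x
      refine ⟨q, ?_⟩
      have : π (r * t) = 0 := (hπ _).2 (Ideal.mem_span_singleton'.2 ⟨r, rfl⟩)
      change π (aeval d q) = π (aeval d q + r * t)
      rw [map_add, this, add_zero]
  let φ := AlgEquiv.ofBijective _ hbij
  refine ⟨φ.symm.toAlgHom.comp π, ?_, ?_, fun x => ?_⟩
  · exact φ.symm.surjective.comp (Ideal.Quotient.mkₐ_surjective ℂ _)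
  · refine φ.symm_apply_eq.2 ?_
    change π d = π (aeval d X)
    rw [aeval_X]
  · rw [← hπ]
    exact φ.symm.map_eq_zero_iff

open Polynomial in
theorem exists_forall_mem_isRoot {J : Ideal ℂ[X]} (hJ : J ≠ ⊤) : ∃ c, ∀ p ∈ J, p.eval c = 0 := by
  obtain ⟨g, rfl⟩ := IsPrincipalIdealRing.principal J
  have hg : g.degree ≠ 0 := fun h =>
    hJ (Ideal.span_singleton_eq_top.2 (Polynomial.isUnit_iff_degree_eq_zero.2 h))
  obtain ⟨c, hc⟩ := IsAlgClosed.exists_root g hg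
  refine ⟨c, fun p hp => ?_⟩
  obtain ⟨a, rfl⟩ := Ideal.mem_span_singleton.1 hp
  rw [eval_mul, hc, zero_mul]

open Polynomial in
/-- A simple module which is a cyclic quotient of `S` factoring through a surjection
`S → ℂ[X]` is one-dimensional. -/
theorem finrank_eq_one_of_ker_le {S M : Type*} [Ring S] [Algebra ℂ S] [AddCommGroup M]
    [Module ℂ M] [Module S M] [IsScalarTower ℂ S M] [IsSimpleModule S M]
    (ψ : S →ₐ[ℂ] ℂ[X]) (hψ : Function.Surjective ψ) (f : S →ₗ[S] M)
    (hf : Function.Surjective f) (hker : ∀ x, ψ x = 0 → f x = 0) :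
    Module.finrank ℂ M = 1 := by
  have hfx : ∀ x, f x = x • f 1 := fun x => by rw [← map_smul, smul_eq_mul, mul_one]
  have hf1 : f 1 ≠ 0 := by
    intro h
    have := IsSimpleModule.nontrivial S M
    obtain ⟨m, hm⟩ := exists_ne (0 : M)
    obtain ⟨x, rfl⟩ := hf m
    exact hm (by rw [hfx, h, smul_zero])
  let J : Ideal ℂ[X] := Ideal.map ψ (LinearMap.ker f)
  have hJmem : ∀ p ∈ J, ∃ x, f x = 0 ∧ ψ x = p := fun p hp => by
    obtain ⟨x, hx, h⟩ := (Ideal.mem_map_iff_of_surjective ψ hψ).1 hp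
    exact ⟨x, hx, h⟩
  have hJ : J ≠ ⊤ := by
    intro h
    obtain ⟨x, hx, hx1⟩ := hJmem 1 (h ▸ Submodule.mem_top)
    have := hker (x - 1) (by rw [map_sub, hx1, map_one, sub_self])
    rw [map_sub, hx, zero_sub, neg_eq_zero] at this
    exact hf1 this
  obtain ⟨c, hc⟩ := exists_forall_mem_isRoot hJ
  let χ : S →ₐ[ℂ] ℂ := (aeval c).comp ψ
  have hle : LinearMap.ker f ≤ RingHom.ker χ := fun x hx => by
    have := hc (ψ x) (Ideal.mem_map_of_mem ψ hx)
    rw [RingHom.mem_ker]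
    simpa [χ, coe_aeval_eq_eval] using this
  have hco : IsCoatom (LinearMap.ker f) := by
    rw [← isSimpleModule_iff_isCoatom]
    exact IsSimpleModule.congr (f.quotKerEquivOfSurjective hf)
  have heq : RingHom.ker χ = LinearMap.ker f :=
    ((hco.le_iff.1 hle).resolve_left (RingHom.ker_ne_top χ))
  refine finrank_eq_one (f 1) hf1 fun m => ?_
  obtain ⟨x, rfl⟩ := hf m
  refine ⟨χ x, ?_⟩
  have hx : x - algebraMap ℂ S (χ x) ∈ LinearMap.ker f := by
    rw [← heq, RingHom.mem_ker, map_sub, AlgHom.commutes]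
    simp
  rw [LinearMap.mem_ker, map_sub, sub_eq_zero] at hx
  rw [hx, hfx (algebraMap ℂ S (χ x)), algebraMap_smul]

section Operators

open Polynomial

theorem Tm_apply (f : ℂ[X]) : Tm f = X * f := rfl

theorem Tm_mul_Dt_apply (f : ℂ[X]) : (Tm * Dt) f = X * derivative f := rfl

theorem Tm_sq_mul_Dt_apply (f : ℂ[X]) : (Tm ^ 2 * Dt) f = X * (X * derivative f) := by
  rw [pow_two]; rfl

theorem Tm_sq_mul_Dt_X_pow (n : ℕ) :
    (Tm ^ 2 * Dt) (X ^ n : ℂ[X]) = (n : ℂ) • X ^ (n + 1) := by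
  rw [Tm_sq_mul_Dt_apply]
  cases n with
  | zero => simp
  | succ n => simp [smul_eq_C_mul]; ring

theorem Tm_mul_Dt_X_pow (n : ℕ) : (Tm * Dt) (X ^ n : ℂ[X]) = (n : ℂ) • X ^ n := by
  rw [Tm_mul_Dt_apply]
  cases n with
  | zero => simp
  | succ n => simp [smul_eq_C_mul]; ring

theorem Tm_mul_Tm_mul_Dt : Tm * (Tm * Dt) = (Tm * Dt - 1) * Tm := by
  refine LinearMap.ext fun f => ?_
  simp only [Module.End.mul_apply, LinearMap.sub_apply, Module.End.one_apply, Tm_apply, Dt,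
    derivative_mul, derivative_X]
  ring

theorem Tm_mul_Tm_sq_mul_Dt : Tm * (Tm ^ 2 * Dt) = (Tm ^ 2 * Dt - Tm) * Tm := by
  refine LinearMap.ext fun f => ?_
  simp only [pow_two, Module.End.mul_apply, LinearMap.sub_apply, Tm_apply, Dt,
    derivative_mul, derivative_X]
  ring

theorem X_pow_dvd_of_mem_R1 {r : Module.End ℂ ℂ[X]} (hr : r ∈ R1) (n : ℕ) :
    ∀ f : ℂ[X], X ^ n ∣ f → X ^ n ∣ r f := by
  induction hr using Algebra.adjoin_induction with
  | mem r hr =>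
    rintro f hf
    rcases hr with rfl | rfl
    · exact hf.mul_left X
    · obtain ⟨g, rfl⟩ := hf
      rw [Tm_mul_Dt_apply, derivative_mul, mul_add, ← mul_assoc, ← Tm_mul_Dt_apply,
        Tm_mul_Dt_X_pow]
      exact dvd_add (Dvd.dvd.mul_right (dvd_smul_of_dvd _ dvd_rfl) _)
        ((dvd_mul_right _ _).mul_left _)
  | algebraMap c =>
    intro f hf
    rw [Module.algebraMap_end_apply, smul_eq_C_mul]
    exact hf.mul_left _
  | add r s _ _ hr hs => exact fun f hf => dvd_add (hr f hf) (hs f hf)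
  | mul r s _ _ hr hs => exact fun f hf => hr _ (hs f hf)

theorem R0_le_R1 : R0 ≤ R1 := by
  have hT : Tm ∈ R1 := Algebra.subset_adjoin (by simp)
  refine Algebra.adjoin_le ?_
  rintro x (rfl | rfl)
  · exact hT
  · rw [pow_two, mul_assoc]
    exact mul_mem hT (Algebra.subset_adjoin (by simp))

theorem coeff_apply_X_pow_eq_zero {r : Module.End ℂ ℂ[X]} (hr : r ∈ R1) {m n : ℕ}
    (h : m < n) : (r (X ^ n)).coeff m = 0 :=
  X_pow_dvd_iff.1 (X_pow_dvd_of_mem_R1 hr n _ dvd_rfl) m h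

theorem eq_zero_of_eval_natCast {p : ℂ[X]} (h : ∀ n : ℕ, p.eval (n : ℂ) = 0) : p = 0 :=
  eq_zero_of_infinite_isRoot p <|
    (Set.infinite_range_of_injective (Nat.cast_injective (R := ℂ))).mono (by
      rintro _ ⟨n, rfl⟩
      exact h n)

theorem aeval_Tm_mul_Dt_X_pow (q : ℂ[X]) (n : ℕ) :
    aeval (Tm * Dt) q (X ^ n : ℂ[X]) = q.eval (n : ℂ) • X ^ n :=
  Module.End.aeval_apply_of_hasEigenvector
    ⟨Module.End.mem_eigenspace_iff.2 (Tm_mul_Dt_X_pow n), pow_ne_zero n X_ne_zero⟩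

theorem eq_zero_of_aeval_Tm_mul_Dt {q : ℂ[X]} {r : Module.End ℂ ℂ[X]} (hr : r ∈ R1)
    (h : aeval (Tm * Dt) q = r * Tm) : q = 0 := by
  refine eq_zero_of_eval_natCast fun n => ?_
  have := congrArg (fun a : Module.End ℂ ℂ[X] => (a (X ^ n)).coeff n) h
  simpa [aeval_Tm_mul_Dt_X_pow, Tm_apply, ← pow_succ',
    coeff_apply_X_pow_eq_zero hr n.lt_succ_self] using this

theorem exists_coeff_eq_eval_of_mem_R0 {r : Module.End ℂ ℂ[X]} (hr : r ∈ R0) (k : ℕ) :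
    ∃ P : ℂ[X], P.natDegree ≤ k ∧ ∀ n : ℕ, (r (X ^ n)).coeff (n + k) = P.eval (n : ℂ) := by
  let p : Module.End ℂ ℂ[X] → Prop := fun r => r ∈ R0 ∧ ∀ k, ∃ P : ℂ[X], P.natDegree ≤ k ∧
    ∀ n : ℕ, (r (X ^ n)).coeff (n + k) = P.eval (n : ℂ)
  have low : ∀ {x : Module.End ℂ ℂ[X]}, x ∈ R0 → ∀ {n m : ℕ}, m < n → (x (X ^ n)).coeff m = 0 :=
    fun hx => coeff_apply_X_pow_eq_zero (R0_le_R1 hx)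
  have hmul : ∀ x, p x → p (r * x) := by
    induction hr using Algebra.adjoin_induction with
    | mem r hr =>
      rintro x ⟨hx, hP⟩
      refine ⟨mul_mem (Algebra.subset_adjoin hr) hx, fun k => ?_⟩
      rcases hr with rfl | rfl
      · cases k with
        | zero =>
          refine ⟨0, by simp, fun n => ?_⟩
          rw [Module.End.mul_apply, Tm_apply]
          cases n with
          | zero => simp
          | succ n => simpa using low hx n.lt_succ_self
        | succ k =>
          obtain ⟨P, hd, hP⟩ := hP k
          refine ⟨P, by omega, fun n => ?_⟩
          rw [Module.End.mul_apply, Tm_apply, ← add_assoc, coeff_X_mul, hP]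
      · have key : ∀ (f : ℂ[X]) (m : ℕ), ((Tm ^ 2 * Dt) f).coeff (m + 1) = f.coeff m * m := by
          intro f m
          rw [Tm_sq_mul_Dt_apply, coeff_X_mul]
          cases m with
          | zero => simp
          | succ m => rw [coeff_X_mul, coeff_derivative]; push_cast; ring
        cases k with
        | zero =>
          refine ⟨0, by simp, fun n => ?_⟩
          rw [Module.End.mul_apply]
          cases n with
          | zero => rw [Tm_sq_mul_Dt_apply]; simp
          | succ n => rw [add_zero, key, low hx n.lt_succ_self]; simp
        | succ k =>
          obtain ⟨P, hd, hP⟩ := hP k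
          refine ⟨P * (X + C (k : ℂ)), ?_, fun n => ?_⟩
          · refine natDegree_mul_le.trans ?_
            rw [natDegree_X_add_C]
            omega
          · rw [Module.End.mul_apply, ← add_assoc, key, hP]
            simp
    | algebraMap c =>
      rintro x ⟨hx, hP⟩
      refine ⟨mul_mem (R0.algebraMap_mem c) hx, fun k => ?_⟩
      obtain ⟨P, hd, hP⟩ := hP k
      refine ⟨c • P, (natDegree_smul_le c P).trans hd, fun n => ?_⟩
      rw [Module.End.mul_apply, Module.algebraMap_end_apply, coeff_smul, hP, eval_smul]
    | add r s _ _ hr hs =>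
      intro x hx
      obtain ⟨hr, hP⟩ := hr x hx
      obtain ⟨hs, hQ⟩ := hs x hx
      refine ⟨add_mul r s x ▸ add_mem hr hs, fun k => ?_⟩
      obtain ⟨P, hPd, hP⟩ := hP k
      obtain ⟨Q, hQd, hQ⟩ := hQ k
      refine ⟨P + Q, (natDegree_add_le _ _).trans (max_le hPd hQd), fun n => ?_⟩
      rw [add_mul, LinearMap.add_apply, coeff_add, hP, hQ, eval_add]
    | mul r s _ _ hr hs =>
      intro x hx
      rw [mul_assoc]
      exact hr _ (hs x hx)
  have hone : p 1 := by
    refine ⟨one_mem _, fun k => ?_⟩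
    cases k with
    | zero => exact ⟨1, by simp, by simp⟩
    | succ k => exact ⟨0, by simp, by simp [coeff_X_pow]⟩
  exact mul_one r ▸ (hmul 1 hone).2 k

theorem Tm_sq_mul_Dt_pow_X_pow (k n : ℕ) :
    ((Tm ^ 2 * Dt) ^ k) (X ^ n : ℂ[X]) =
      (ascPochhammer ℂ k).eval (n : ℂ) • X ^ (n + k) := by
  induction k with
  | zero => simp
  | succ k ih =>
    rw [pow_succ', Module.End.mul_apply, ih, map_smul, Tm_sq_mul_Dt_X_pow, smul_smul,
      ascPochhammer_succ_eval, Nat.cast_add, add_assoc]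

theorem coeff_aeval_Tm_sq_mul_Dt_X_pow (q : ℂ[X]) (n k : ℕ) :
    (aeval (Tm ^ 2 * Dt) q (X ^ n : ℂ[X])).coeff (n + k) =
      q.coeff k * (ascPochhammer ℂ k).eval (n : ℂ) := by
  induction q using Polynomial.induction_on' with
  | add p q hp hq => rw [map_add, LinearMap.add_apply, coeff_add, hp, hq, coeff_add, add_mul]
  | monomial m a =>
    rw [aeval_monomial, Module.End.mul_apply, Module.algebraMap_end_apply,
      Tm_sq_mul_Dt_pow_X_pow, coeff_smul, coeff_smul, coeff_X_pow, coeff_monomial]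
    by_cases h : m = k
    · simp [h]
    · simp [h, Ne.symm h]

theorem eq_zero_of_aeval_Tm_sq_mul_Dt {q : ℂ[X]} {r : Module.End ℂ ℂ[X]} (hr : r ∈ R0)
    (h : aeval (Tm ^ 2 * Dt) q = r * Tm) : q = 0 := by
  ext k
  have hcoeff : ∀ n : ℕ, q.coeff k * (ascPochhammer ℂ k).eval (n : ℂ) =
      (r (X ^ (n + 1))).coeff (n + k) := fun n => by
    rw [← coeff_aeval_Tm_sq_mul_Dt_X_pow, h, Module.End.mul_apply, Tm_apply, pow_succ']
  cases k with
  | zero =>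
    have := hcoeff 0
    rw [coeff_apply_X_pow_eq_zero (R0_le_R1 hr) (by omega)] at this
    simpa using this
  | succ k =>
    obtain ⟨P, hd, hP⟩ := exists_coeff_eq_eval_of_mem_R0 hr k
    have heq : C (q.coeff (k + 1)) * ascPochhammer ℂ (k + 1) - P.comp (X + 1) = 0 := by
      refine eq_zero_of_eval_natCast fun n => ?_
      have := hP (n + 1)
      rw [add_right_comm, add_assoc, ← hcoeff] at this
      simp [this]
    have hlead := congrArg (fun p : ℂ[X] => p.coeff (k + 1)) heq
    have hP0 : (P.comp (X + 1)).coeff (k + 1) = 0 := by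
      refine coeff_eq_zero_of_natDegree_lt (natDegree_comp_le.trans_lt ?_)
      rw [← C_1, natDegree_X_add_C]
      omega
    have hmonic : (ascPochhammer ℂ (k + 1)).coeff (k + 1) = 1 := by
      have := monic_ascPochhammer ℂ (k + 1)
      rwa [Monic, leadingCoeff, ascPochhammer_natDegree] at this
    simpa [hP0, hmonic] using hlead

theorem adjoin_pair_eq_top_of_eq_adjoin {B : Type*} [Ring B] [Algebra ℂ B] {S : Subalgebra ℂ B}
    (t d : S) (hS : S = Algebra.adjoin ℂ {(t : B), (d : B)}) :
    Algebra.adjoin ℂ {t, d} = ⊤ := by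
  apply Subalgebra.map_injective (f := S.val) Subtype.val_injective
  rw [AlgHom.map_adjoin, Set.image_pair, Algebra.map_top, Subalgebra.range_val]
  exact hS.symm

theorem exists_algHom_of_eq_R1 {S : Subalgebra ℂ (Module.End ℂ ℂ[X])} (hS : S = R1) (t d : S)
    (ht : (t : Module.End ℂ ℂ[X]) = Tm) (hd : (d : Module.End ℂ ℂ[X]) = Tm * Dt) :
    ∃ ψ : S →ₐ[ℂ] ℂ[X], Function.Surjective ψ ∧ ψ d = X ∧
      ∀ x : S, ψ x = 0 ↔ x ∈ Ideal.span {t} := by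
  refine exists_algHom_polynomial_of_adjoin_eq_top t d (d - 1)
    (adjoin_pair_eq_top_of_eq_adjoin t d (by rw [ht, hd, hS, R1])) ?_ fun q r h => ?_
  · ext1
    simp only [MulMemClass.coe_mul, AddSubgroupClass.coe_sub, OneMemClass.coe_one, ht, hd]
    exact Tm_mul_Tm_mul_Dt
  · refine eq_zero_of_aeval_Tm_mul_Dt (r := r) (hS ▸ r.2) ?_
    have := congrArg S.val h
    rwa [← aeval_algHom_apply, map_mul, S.val_apply, S.val_apply, S.val_apply, ht, hd] at this

theorem exists_algHom_of_eq_R0 {S : Subalgebra ℂ (Module.End ℂ ℂ[X])} (hS : S = R0) (t d : S)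
    (ht : (t : Module.End ℂ ℂ[X]) = Tm) (hd : (d : Module.End ℂ ℂ[X]) = Tm ^ 2 * Dt) :
    ∃ ψ : S →ₐ[ℂ] ℂ[X], Function.Surjective ψ ∧ ψ d = X ∧
      ∀ x : S, ψ x = 0 ↔ x ∈ Ideal.span {t} := by
  refine exists_algHom_polynomial_of_adjoin_eq_top t d (d - t)
    (adjoin_pair_eq_top_of_eq_adjoin t d (by rw [ht, hd, hS, R0])) ?_ fun q r h => ?_
  · ext1
    simp only [MulMemClass.coe_mul, AddSubgroupClass.coe_sub, ht, hd]
    exact Tm_mul_Tm_sq_mul_Dt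
  · refine eq_zero_of_aeval_Tm_sq_mul_Dt (r := r) (hS ▸ r.2) ?_
    have := congrArg S.val h
    rwa [← aeval_algHom_apply, map_mul, S.val_apply, S.val_apply, S.val_apply, ht, hd] at this

theorem exists_algHom_Rz (zc : ℂ) : ∃ ψ : Rz zc →ₐ[ℂ] ℂ[X], Function.Surjective ψ ∧
    ψ (dR zc) = X ∧ ∀ x : Rz zc, ψ x = 0 ↔ x ∈ Ideal.span {tR zc} := by
  by_cases h : zc = 0
  · exact exists_algHom_of_eq_R0 (if_pos h) (tR zc) (dR zc) rfl (if_pos h)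
  · exact exists_algHom_of_eq_R1 (if_neg h) (tR zc) (dR zc) rfl (if_neg h)

end Operators

/-- For each `zc ∈ ℂ` the left ideal `R_zc·t` is a two-sided ideal of
`R_zc`; the quotient `R₁/R₁t` is isomorphic to the commutative polynomial algebra
`ℂ[ts]` in the image of `t(d/dt)`, and `R₀/R₀t` is isomorphic to the commutative
polynomial algebra `ℂ[t²s]` in the image of `t²(d/dt)` (expressed below via surjective
algebra homomorphisms onto `ℂ[X]` sending the generator to `X` and with kernel exactly
the respective ideal).  Consequently, every simple quotient of the left `R_zc`-module
`R_zc/R_zc·t` (i.e. every simple `R_zc`-module receiving a surjection from `R_zc`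
killing `t`) is one-dimensional. -/
theorem Rz_mod_t (zc : ℂ) :
    (∀ x ∈ Ideal.span {tR zc}, ∀ r : Rz zc, x * r ∈ Ideal.span {tR zc}) ∧
    (∃ ψ : R1 →ₐ[ℂ] Polynomial ℂ, Function.Surjective ψ ∧ ψ dR1 = Polynomial.X ∧
      ∀ x : R1, ψ x = 0 ↔ x ∈ Ideal.span {tR1}) ∧
    (∃ ψ : R0 →ₐ[ℂ] Polynomial ℂ, Function.Surjective ψ ∧ ψ dR0 = Polynomial.X ∧
      ∀ x : R0, ψ x = 0 ↔ x ∈ Ideal.span {tR0}) ∧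
    (∀ (M : Type) (_ : AddCommGroup M) (_ : Module ℂ M) (_ : Module (Rz zc) M)
        (_ : IsScalarTower ℂ (Rz zc) M) (f : Rz zc →ₗ[Rz zc] M),
      Function.Surjective f → f (tR zc) = 0 → IsSimpleModule (Rz zc) M →
      Module.finrank ℂ M = 1) := by
  obtain ⟨ψ, hψ, -, hker⟩ := exists_algHom_Rz zc
  refine ⟨fun x hx r => ?_, exists_algHom_of_eq_R1 rfl tR1 dR1 rfl rfl,
    exists_algHom_of_eq_R0 rfl tR0 dR0 rfl rfl, ?_⟩
  · rw [← hker] at hx ⊢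
    rw [map_mul, hx, zero_mul]
  · intro M _ _ _ _ f hf hft _
    refine finrank_eq_one_of_ker_le (S := Rz zc) (M := M) ψ hψ f hf fun x hx => ?_
    obtain ⟨r, rfl⟩ := Ideal.mem_span_singleton'.1 ((hker x).1 hx)
    rw [← smul_eq_mul, map_smul, hft, smul_zero]

end
end
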